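/- arXiv:1603.02239 — 4 statements merged into one kernel-verified Lean document; each statement's English description precedes it below -/
import Mathlib

section
/- Under the full assumptions and Algorithm 1, there exists a minimizer x* ∈ X* such that lim_{k→∞} ‖x_i(k) − x*‖ = 0 for every i = 1,…,m, i.e., all agents' local iterates converge to one common minimizer of the centralized problem. -/
open Filter Finset Metric
open scoped Topology BigOperators

/-- The product `a (k + s - 1) ⋯ a k` of consecutive weight matrices. -/
def transition {ι : Type*} [Fintype ι] [DecidableEq ι] (a : ℕ → ι → ι → ℝ) (k : ℕ) :
    ℕ → ι → ι → ℝ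
  | 0 => fun i j => if i = j then 1 else 0
  | s + 1 => fun i j => ∑ l, a (k + s) i l * transition a k s l j

section Transition

variable {ι : Type*} [Fintype ι] [DecidableEq ι] {a : ℕ → ι → ι → ℝ}

lemma transition_nonneg (ha : ∀ k i j, 0 ≤ a k i j) (k s : ℕ) (i j : ι) :
    0 ≤ transition a k s i j := by
  induction s generalizing i with
  | zero => unfold transition; split_ifs <;> norm_num
  | succ s ih =>
    unfold transition
    exact sum_nonneg fun l _ => mul_nonneg (ha _ _ _) (ih l)

lemma sum_transition (ha : ∀ k i, ∑ j, a k i j = 1) (k s : ℕ) (i : ι) :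
    ∑ j, transition a k s i j = 1 := by
  induction s generalizing i with
  | zero => simp [transition]
  | succ s ih =>
    unfold transition
    rw [sum_comm]
    simp_rw [← mul_sum, ih, mul_one, ha]

lemma pow_le_transition_succ (ha : ∀ k i j, 0 ≤ a k i j) {η : ℝ} (hη : 0 < η)
    {k s : ℕ} {i l j : ι} (hl : η ≤ a (k + s) i l) (h : η ^ s ≤ transition a k s l j) :
    η ^ (s + 1) ≤ transition a k (s + 1) i j := by
  have hle : a (k + s) i l * transition a k s l j ≤ transition a k (s + 1) i j := by
    conv_rhs => unfold transition
    exact single_le_sum (f := fun l => a (k + s) i l * transition a k s l j)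
      (fun r _ => mul_nonneg (ha _ _ _) (transition_nonneg ha _ _ _ _)) (mem_univ l)
  refine le_trans ?_ hle
  rw [pow_succ, mul_comm]
  exact mul_le_mul hl h (pow_nonneg hη.le _) (ha _ _ _)

lemma pow_le_transition_of_le (ha : ∀ k i j, 0 ≤ a k i j) {η : ℝ} (hη : 0 < η)
    (ha_diag : ∀ k i, η ≤ a k i i) {k s t : ℕ} (hst : s ≤ t) {i j : ι}
    (h : η ^ s ≤ transition a k s i j) : η ^ t ≤ transition a k t i j := by
  induction t, hst using Nat.le_induction with
  | base => exact h
  | succ t _ ih => exact pow_le_transition_succ ha hη (ha_diag _ _) ih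

/-- Under recurrent strong connectivity, long enough products of the weight matrices are
uniformly positive. -/
lemma exists_pow_le_transition (ha : ∀ k i j, 0 ≤ a k i j) {η : ℝ} (hη : 0 < η)
    (ha_diag : ∀ k i, η ≤ a k i i) (ha_eta : ∀ k i j, 0 < a k i j → η ≤ a k i j)
    (hconn : ∀ u v : ι,
      Relation.ReflTransGen (fun p q => {k : ℕ | 0 < a k q p}.Infinite) u v)
    {T : ℕ}
    (hT : ∀ j i : ι, {k : ℕ | 0 < a k i j}.Infinite →
      ∀ k : ℕ, ∃ l, k ≤ l ∧ l < k + T ∧ 0 < a l i j) :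
    ∃ B : ℕ, ∀ k i j, η ^ B ≤ transition a k B i j := by
  have key : ∀ i j : ι, ∃ N : ℕ, ∀ k, ∀ s, N ≤ s → η ^ s ≤ transition a k s i j := by
    intro i j
    induction hconn j i with
    | refl =>
      exact ⟨0, fun k s hs => pow_le_transition_of_le ha hη ha_diag hs (by simp [transition])⟩
    | @tail p q _ hpq ih =>
      obtain ⟨N, hN⟩ := ih
      refine ⟨N + T, fun k s hs => ?_⟩
      obtain ⟨l, hl1, hl2, hl3⟩ := hT p q hpq (k + N)
      obtain ⟨r, rfl⟩ := Nat.exists_eq_add_of_le (show k ≤ l by omega)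
      exact pow_le_transition_of_le ha hη ha_diag (show r + 1 ≤ s by omega)
        (pow_le_transition_succ ha hη (ha_eta _ _ _ hl3) (hN k r (by omega)))
  choose N hN using key
  refine ⟨∑ i, ∑ j, N i j, fun k i j => hN i j k _ ?_⟩
  exact (single_le_sum (f := fun j => N i j) (fun _ _ => Nat.zero_le _) (mem_univ j)).trans
    (single_le_sum (f := fun i => ∑ j, N i j) (fun _ _ => Nat.zero_le _) (mem_univ i))

variable {E : Type*} [SeminormedAddCommGroup E] [NormedSpace ℝ E]

/-- A perturbed averaging recursion stays close to the unperturbed one. -/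
lemma norm_sub_sum_transition_le (ha : ∀ k i j, 0 ≤ a k i j) (ha_row : ∀ k i, ∑ j, a k i j = 1)
    {x : ι → ℕ → E} {w : ℕ → ℝ}
    (hx : ∀ i k, ‖x i (k + 1) - ∑ j, a k i j • x j k‖ ≤ w k) (k s : ℕ) (i : ι) :
    ‖x i (k + s) - ∑ j, transition a k s i j • x j k‖ ≤ ∑ t ∈ range s, w (k + t) := by
  induction s generalizing i with
  | zero => simp [transition]
  | succ s ih =>
    have hsplit : x i (k + (s + 1)) - ∑ j, transition a k (s + 1) i j • x j k
        = ∑ l, a (k + s) i l • (x l (k + s) - ∑ j, transition a k s l j • x j k)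
          + (x i (k + s + 1) - ∑ j, a (k + s) i j • x j (k + s)) := by
      have : ∑ j, transition a k (s + 1) i j • x j k
          = ∑ l, a (k + s) i l • ∑ j, transition a k s l j • x j k := by
        conv_lhs => unfold transition
        simp_rw [sum_smul, smul_sum, mul_smul]
        exact sum_comm
      rw [this]
      simp_rw [smul_sub, sum_sub_distrib, ← add_assoc]
      abel
    rw [hsplit, sum_range_succ]
    refine (norm_add_le _ _).trans (add_le_add ?_ (hx _ _))
    calc _ ≤ ∑ l, ‖a (k + s) i l • (x l (k + s) - ∑ j, transition a k s l j • x j k)‖ :=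
          norm_sum_le _ _
      _ ≤ ∑ l, a (k + s) i l * ∑ t ∈ range s, w (k + t) := by
          refine sum_le_sum fun l _ => ?_
          rw [norm_smul, Real.norm_of_nonneg (ha _ _ _)]
          exact mul_le_mul_of_nonneg_left (ih l) (ha _ _ _)
      _ = _ := by rw [← sum_mul, ha_row, one_mul]

end Transition

/-- Averages with weights bounded below by `δ` contract diameters by the factor `1 - δ`. -/
lemma norm_sum_smul_sub_sum_smul_le {ι : Type*} [Fintype ι] {E : Type*} [SeminormedAddCommGroup E]
    [NormedSpace ℝ E] {p q : ι → ℝ} {x : ι → E} {δ D : ℝ}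
    (hp : ∀ i, 0 ≤ p i) (hq : ∀ i, 0 ≤ q i) (hδ : ∀ i, δ ≤ q i)
    (hp1 : ∑ i, p i = 1) (hq1 : ∑ i, q i = 1) (hx : ∀ i j, ‖x i - x j‖ ≤ D) (hD : 0 ≤ D) :
    ‖∑ i, p i • x i - ∑ i, q i • x i‖ ≤ (1 - δ) * D := by
  classical
  have h1 : ∑ i, p i • x i - ∑ i, q i • x i = ∑ i, ∑ j, (p i * q j) • (x i - x j) := by
    simp_rw [smul_sub, sum_sub_distrib, ← sum_smul, ← mul_sum, hq1, mul_one]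
    rw [sum_comm (f := fun i j => (p i * q j) • x j)]
    simp_rw [← sum_smul, ← sum_mul, hp1, one_mul]
  have h2 : ∀ i j, ‖(p i * q j) • (x i - x j)‖
      ≤ (p i * q j - if i = j then p i * q i else 0) * D := by
    intro i j
    split_ifs with h
    · subst h; simp
    · rw [norm_smul, Real.norm_of_nonneg (mul_nonneg (hp _) (hq _)), sub_zero]
      exact mul_le_mul_of_nonneg_left (hx _ _) (mul_nonneg (hp _) (hq _))
  have h3 : δ ≤ ∑ i, p i * q i := by
    calc δ = ∑ i, p i * δ := by rw [← sum_mul, hp1, one_mul]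
      _ ≤ _ := sum_le_sum fun i _ => mul_le_mul_of_nonneg_left (hδ i) (hp i)
  calc _ ≤ ∑ i, ∑ j, (p i * q j - if i = j then p i * q i else 0) * D := by
        rw [h1]
        exact (norm_sum_le _ _).trans (sum_le_sum fun i _ =>
          (norm_sum_le _ _).trans (sum_le_sum fun j _ => h2 i j))
    _ = (1 - ∑ i, p i * q i) * D := by
        simp_rw [← sum_mul, sum_sub_distrib, ← mul_sum, hq1, mul_one, hp1]
        simp
    _ ≤ _ := mul_le_mul_of_nonneg_right (by linarith) hD

/-- Summation of a contraction inequality over a window of length `B`. -/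
lemma sum_range_succ_le_of_window_contraction {u w : ℕ → ℝ} {q C : ℝ} {B : ℕ}
    (hu : ∀ k, 0 ≤ u k) (hw : ∀ k, 0 ≤ w k) (hq0 : 0 ≤ q) (hq : q < 1) (hC : 0 ≤ C)
    (h : ∀ k, u (k + B) ≤ q * u k + C * ∑ t ∈ range B, w (k + t)) (N : ℕ) :
    ∑ k ∈ range (N + 1), u k
      ≤ (∑ k ∈ range B, u k + C * B * ∑ k ∈ range N, w k) / (1 - q) := by
  have hmono : ∀ {v : ℕ → ℝ}, (∀ k, 0 ≤ v k) → ∀ {r s : ℕ}, r ≤ s →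
      ∑ k ∈ range r, v k ≤ ∑ k ∈ range s, v k := fun hv _ _ hrs =>
    sum_le_sum_of_subset_of_nonneg (range_mono hrs) fun _ _ _ => hv _
  have hW : 0 ≤ C * B * ∑ k ∈ range N, w k :=
    mul_nonneg (mul_nonneg hC (Nat.cast_nonneg _)) (sum_nonneg fun _ _ => hw _)
  have hS : 0 ≤ ∑ k ∈ range (N + 1), u k := sum_nonneg fun _ _ => hu _
  rw [le_div_iff₀ (by linarith)]
  rcases le_total (N + 1) B with hNB | hNB
  · have := hmono hu hNB
    nlinarith
  · obtain ⟨M, hM⟩ := Nat.exists_eq_add_of_le hNB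
    have h1 : ∑ k ∈ range (N + 1), u k = ∑ k ∈ range B, u k + ∑ k ∈ range M, u (k + B) := by
      rw [hM, sum_range_add]
      simp_rw [add_comm B]
    have h2 : ∑ k ∈ range M, u (k + B)
        ≤ q * ∑ k ∈ range M, u k + C * ∑ t ∈ range B, ∑ k ∈ range M, w (k + t) := by
      rw [sum_comm, mul_sum, mul_sum, ← sum_add_distrib]
      exact sum_le_sum fun k _ => h k
    have h3 : ∑ t ∈ range B, ∑ k ∈ range M, w (k + t) ≤ B * ∑ k ∈ range N, w k := by
      calc _ ≤ ∑ t ∈ range B, ∑ k ∈ range N, w k := by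
            refine sum_le_sum fun t ht => ?_
            have ht := mem_range.1 ht
            rcases M.eq_zero_or_pos with rfl | hM0
            · simpa using sum_nonneg fun _ _ => hw _
            · calc _ = ∑ k ∈ range M, w (t + k) := by simp_rw [add_comm]
                _ ≤ ∑ k ∈ range (t + M), w k := by
                  rw [sum_range_add]
                  linarith [sum_nonneg (s := range t) fun k _ => hw k]
                _ ≤ _ := hmono hw (by omega)
        _ = _ := by simp
    have h4 : ∑ k ∈ range M, u k ≤ ∑ k ∈ range (N + 1), u k := hmono hu (by omega)
    have h5 := mul_le_mul_of_nonneg_left h3 hC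
    have h6 := mul_le_mul_of_nonneg_left h4 hq0
    nlinarith

/-- The three-point inequality for the proximal step. -/
lemma proximal_three_point {E : Type*} [NormedAddCommGroup E] [InnerProductSpace ℝ E]
    {S : Set E} {g : E → ℝ} (hg : ConvexOn ℝ S g) {c : ℝ} (hc : 0 < c) {z p : E} (hp : p ∈ S)
    (hmin : ∀ y ∈ S, g p + (1 / (2 * c)) * ‖z - p‖ ^ 2 ≤ g y + (1 / (2 * c)) * ‖z - y‖ ^ 2)
    {y : E} (hy : y ∈ S) :
    2 * c * (g p - g y) + ‖p - z‖ ^ 2 + ‖p - y‖ ^ 2 ≤ ‖z - y‖ ^ 2 := by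
  have key : ∀ t ∈ Set.Ioo (0 : ℝ) 1,
      2 * c * (g p - g y) + ‖p - z‖ ^ 2 + ‖p - y‖ ^ 2 - ‖z - y‖ ^ 2 ≤ t * ‖p - y‖ ^ 2 := by
    rintro t ⟨ht0, ht1⟩
    have h1 := hmin _ (hg.1 hp hy (by linarith : 0 ≤ 1 - t) ht0.le (by ring))
    have h2 := hg.2 hp hy (by linarith : 0 ≤ 1 - t) ht0.le (by ring)
    have h3 : ‖z - ((1 - t) • p + t • y)‖ ^ 2
        = (1 - t) * ‖p - z‖ ^ 2 + t * ‖z - y‖ ^ 2 - t * (1 - t) * ‖p - y‖ ^ 2 := by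
      have e1 : z - ((1 - t) • p + t • y) = (z - y) - (1 - t) • (p - y) := by module
      have e2 : p - z = (p - y) - (z - y) := by abel
      rw [e1, e2, norm_sub_sq_real, norm_sub_sq_real (p - y) (z - y), norm_smul, inner_smul_right,
        real_inner_comm (z - y) (p - y), mul_pow, Real.norm_eq_abs, sq_abs]
      ring
    rw [h3, norm_sub_rev z p] at h1
    simp only [smul_eq_mul] at h2
    have h4 := mul_le_mul_of_nonneg_left (h1.trans (add_le_add_left h2 _)) (by linarith : 0 ≤ 2 * c)
    have h5 : ∀ r : ℝ, 2 * c * (1 / (2 * c) * r) = r := fun r => by field_simp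
    rw [mul_add, mul_add, h5, h5] at h4
    refine le_of_mul_le_mul_left ?_ ht0
    nlinarith
  have hlim : Tendsto (fun t : ℝ => t * ‖p - y‖ ^ 2) (𝓝[>] 0) (𝓝 0) := by
    have : Tendsto (fun t : ℝ => t * ‖p - y‖ ^ 2) (𝓝 0) (𝓝 (0 * ‖p - y‖ ^ 2)) :=
      tendsto_id.mul_const _
    rw [zero_mul] at this
    exact this.mono_left nhdsWithin_le_nhds
  have := ge_of_tendsto hlim (Filter.mem_of_superset (Ioo_mem_nhdsGT one_pos) key)
  linarith

lemma norm_sum_smul_sub_sq_le {ι : Type*} [Fintype ι] {E : Type*} [SeminormedAddCommGroup E]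
    [NormedSpace ℝ E] {p : ι → ℝ} (hp : ∀ i, 0 ≤ p i) (hp1 : ∑ i, p i = 1) (x : ι → E) (y : E) :
    ‖∑ i, p i • x i - y‖ ^ 2 ≤ ∑ i, p i * ‖x i - y‖ ^ 2 := by
  have h : ConvexOn ℝ Set.univ fun v : E => ‖v‖ ^ 2 :=
    (convexOn_univ_norm (E := E)).pow (fun _ _ => norm_nonneg _) 2
  have h1 := h.map_sum_le (t := univ) (p := fun i => x i - y) (fun i _ => hp i) hp1
    fun _ _ => Set.mem_univ _
  simpa [smul_sub, ← sum_smul, hp1] using h1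

/-- A point within `D` of each of the points `x j ∈ X j` can be moved by at most a multiple of `D`
into the intersection of the `X j`, provided the latter contains a ball. -/
lemma exists_mem_iInter_norm_sub_le {ι : Type*} {E : Type*} [NormedAddCommGroup E]
    [NormedSpace ℝ E] {X : ι → Set E} (hX : ∀ i, Convex ℝ (X i)) {c : E} {r R : ℝ} (hr : 0 < r)
    (hball : closedBall c r ⊆ ⋂ i, X i) {x : ι → E} (hx : ∀ i, x i ∈ X i) {p : E} {D : ℝ}
    (hD : ∀ i, ‖p - x i‖ ≤ D) (hD0 : 0 ≤ D) (hR : ‖c - p‖ ≤ R) :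
    ∃ v ∈ ⋂ i, X i, ‖v - p‖ ≤ R / r * D := by
  have hpos : 0 < D + r := by linarith
  refine ⟨(r / (D + r)) • p + (D / (D + r)) • c, Set.mem_iInter.2 fun i => ?_, ?_⟩
  · rcases hD0.eq_or_lt with rfl | hDpos
    · have : p = x i := sub_eq_zero.1 (norm_le_zero_iff.1 (hD i))
      simpa [hr.ne', this] using hx i
    · have hmem : c + (r / D) • (p - x i) ∈ X i := by
        refine Set.mem_iInter.1 (hball ?_) i
        rw [mem_closedBall, dist_eq_norm, add_sub_cancel_left, norm_smul,
          Real.norm_of_nonneg (by positivity), div_mul_eq_mul_div, div_le_iff₀ hDpos]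
        exact mul_le_mul_of_nonneg_left (hD i) hr.le
      have := hX i (hx i) hmem (by positivity : 0 ≤ r / (D + r))
        (by positivity : 0 ≤ D / (D + r)) (by field_simp; ring)
      convert this using 1
      have e : D / (D + r) * (r / D) = r / (D + r) := by field_simp
      rw [smul_add, smul_smul, e]
      module
  · have e : (r / (D + r)) • p + (D / (D + r)) • c - p = (D / (D + r)) • (c - p) := by
      have : r / (D + r) = 1 - D / (D + r) := by field_simp; ring
      rw [this]; module
    rw [e, norm_smul, Real.norm_of_nonneg (by positivity), div_mul_eq_mul_div R, mul_comm R]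
    calc D / (D + r) * ‖c - p‖ ≤ D / r * R := by
          gcongr
          linarith
      _ = _ := by ring

/-- A nonnegative sequence whose increments have a summable upper bound converges. -/
lemma exists_tendsto_of_le_add_summable {u b : ℕ → ℝ} (hu : ∀ k, 0 ≤ u k) (hb : Summable b)
    (h : ∀ k, u (k + 1) ≤ u k + b k) : ∃ l, Tendsto u atTop (𝓝 l) := by
  have hanti : Antitone fun k => u k - ∑ j ∈ range k, b j := by
    refine antitone_nat_of_succ_le fun k => ?_
    rw [sum_range_succ]
    linarith [h k]
  have hsum := hb.hasSum.tendsto_sum_nat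
  obtain ⟨C, hC⟩ := hsum.bddAbove_range
  have hbdd : BddBelow (Set.range fun k => u k - ∑ j ∈ range k, b j) := by
    refine ⟨-C, ?_⟩
    rintro _ ⟨k, rfl⟩
    have := hC ⟨k, rfl⟩
    have h2 := hu k
    simp only at this ⊢
    linarith
  exact ⟨_, by simpa using (tendsto_atTop_ciInf hanti hbdd).add hsum⟩

lemma frequently_lt_of_summable_mul {c g : ℕ → ℝ} (hc : ∀ k, 0 < c k)
    (hc_div : Tendsto (fun N => ∑ k ∈ range N, c k) atTop atTop)
    (hs : Summable fun k => c k * g k) {ε : ℝ} (hε : 0 < ε) : ∃ᶠ k in atTop, g k < ε := by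
  intro hev
  have h1 : Summable fun k => c k * ε := by
    refine summable_of_isBigO_nat hs (Asymptotics.IsBigO.of_bound 1 ?_)
    filter_upwards [hev] with k hk
    have hk : ε ≤ g k := not_lt.1 hk
    rw [Real.norm_of_nonneg (mul_nonneg (hc k).le hε.le),
      Real.norm_of_nonneg (mul_nonneg (hc k).le (hε.le.trans hk)), one_mul]
    exact mul_le_mul_of_nonneg_left hk (hc k).le
  have h2 : Summable c := (summable_mul_right_iff hε.ne').1 h1
  exact not_tendsto_nhds_of_tendsto_atTop hc_div _ h2.hasSum.tendsto_sum_nat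

lemma ConvexOn.exists_norm_sub_le_closedBall {E : Type*} [NormedAddCommGroup E] [NormedSpace ℝ E]
    [FiniteDimensional ℝ E] {g : E → ℝ} (hg : ConvexOn ℝ Set.univ g) (R : ℝ) :
    ∃ L : ℝ, 0 ≤ L ∧ ∀ x ∈ closedBall (0 : E) R, ∀ y ∈ closedBall (0 : E) R,
      ‖g x - g y‖ ≤ L * ‖x - y‖ := by
  have hcont : Continuous g := hg.locallyLipschitz.continuous
  have hb : Bornology.IsBounded (g '' ball 0 (R + 2)) :=
    ((isCompact_closedBall (0 : E) (R + 2)).image hcont).isBounded.subset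
      (Set.image_mono ball_subset_closedBall)
  obtain ⟨K, hK⟩ := (hg.subset (Set.subset_univ _) (convex_ball 0 (R + 2))
    ).exists_lipschitzOnWith_of_isBounded (by linarith : R + 1 < R + 2) hb
  refine ⟨K, K.2, fun x hx y hy => ?_⟩
  exact hK.norm_sub_le (closedBall_subset_ball (by linarith) hx)
    (closedBall_subset_ball (by linarith) hy)

/-- In a perturbed averaging recursion the squared disagreement is summable as soon as the squared
perturbations are, with explicit control of the partial sums. -/
lemma exists_disagreement_bound {ι : Type*} [Fintype ι] {E : Type*} [SeminormedAddCommGroup E]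
    [NormedSpace ℝ E] {a : ℕ → ι → ι → ℝ} (ha : ∀ k i j, 0 ≤ a k i j)
    (ha_row : ∀ k i, ∑ j, a k i j = 1) {η : ℝ} (hη : η ∈ Set.Ioo (0 : ℝ) 1)
    (ha_diag : ∀ k i, η ≤ a k i i) (ha_eta : ∀ k i j, 0 < a k i j → η ≤ a k i j)
    (hconn : ∀ u v : ι,
      Relation.ReflTransGen (fun p q => {k : ℕ | 0 < a k q p}.Infinite) u v)
    {T : ℕ}
    (hT : ∀ j i : ι, {k : ℕ | 0 < a k i j}.Infinite →
      ∀ k : ℕ, ∃ l, k ≤ l ∧ l < k + T ∧ 0 < a l i j)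
    {x : ι → ℕ → E} {w : ℕ → ℝ} (hw : ∀ k, 0 ≤ w k)
    (hx : ∀ i k, ‖x i (k + 1) - ∑ j, a k i j • x j k‖ ≤ w k) :
    ∃ (D : ℕ → ℝ) (C₀ C₁ : ℝ), 0 ≤ C₁ ∧ (∀ k, 0 ≤ D k) ∧ (∀ k i j, ‖x i k - x j k‖ ≤ D k) ∧
      ∀ N, ∑ k ∈ range (N + 1), D k ^ 2 ≤ C₀ + C₁ * ∑ k ∈ range N, w k ^ 2 := by
  classical
  obtain ⟨B, hB⟩ := exists_pow_le_transition ha hη.1 ha_diag ha_eta hconn hT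
  have hδ0 : 0 < η ^ B := pow_pos hη.1 B
  have hδ1 : η ^ B ≤ 1 := pow_le_one₀ hη.1.le hη.2.le
  set δ := η ^ B
  set D : ℕ → ℝ := fun k => diam (Set.range fun i => x i k) with hD
  have hD0 : ∀ k, 0 ≤ D k := fun k => diam_nonneg
  have hxD : ∀ k i j, ‖x i k - x j k‖ ≤ D k := fun k i j => by
    rw [← dist_eq_norm]
    exact dist_le_diam_of_mem (Set.finite_range _).isBounded ⟨i, rfl⟩ ⟨j, rfl⟩
  have hstep : ∀ k, D (k + B) ≤ (1 - δ) * D k + 2 * ∑ t ∈ range B, w (k + t) := by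
    intro k
    have hW : 0 ≤ ∑ t ∈ range B, w (k + t) := sum_nonneg fun _ _ => hw _
    refine diam_le_of_forall_dist_le
      (add_nonneg (mul_nonneg (by linarith) (hD0 k)) (by linarith)) ?_
    rintro _ ⟨i, rfl⟩ _ ⟨j, rfl⟩
    have h1 := norm_sub_sum_transition_le ha ha_row hx k B i
    have h2 := norm_sub_sum_transition_le ha ha_row hx k B j
    have h3 := norm_sum_smul_sub_sum_smul_le (transition_nonneg ha k B i)
      (transition_nonneg ha k B j) (hB k j) (sum_transition ha_row k B i)
      (sum_transition ha_row k B j) (hxD k) (hD0 k)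
    rw [dist_eq_norm]
    rw [norm_sub_rev] at h2
    have h4 := norm_add₃_le (a := x i (k + B) - ∑ l, transition a k B i l • x l k)
      (b := ∑ l, transition a k B i l • x l k - ∑ l, transition a k B j l • x l k)
      (c := ∑ l, transition a k B j l • x l k - x j (k + B))
    rw [sub_add_sub_cancel, sub_add_sub_cancel] at h4
    linarith
  have hsq : ∀ k, D (k + B) ^ 2
      ≤ (1 - δ) * D k ^ 2 + 4 * B / δ * ∑ t ∈ range B, w (k + t) ^ 2 := by
    intro k
    have h1 := pow_le_pow_left₀ (hD0 _) (hstep k) 2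
    have h2 : (∑ t ∈ range B, w (k + t)) ^ 2 ≤ B * ∑ t ∈ range B, w (k + t) ^ 2 := by
      simpa using sq_sum_le_card_mul_sum_sq (s := range B) (f := fun t => w (k + t))
    set S := ∑ t ∈ range B, w (k + t)
    have h3 : ((1 - δ) * D k + 2 * S) ^ 2 ≤ (1 - δ) * D k ^ 2 + 4 * S ^ 2 / δ := by
      rw [← sub_le_iff_le_add', le_div_iff₀ hδ0]
      nlinarith [mul_nonneg (sub_nonneg.2 hδ1) (sq_nonneg (δ * D k - 2 * S))]
    have h4 : 4 * S ^ 2 / δ ≤ 4 * B / δ * ∑ t ∈ range B, w (k + t) ^ 2 := by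
      rw [div_mul_eq_mul_div, div_le_div_iff_of_pos_right hδ0]
      linarith
    linarith
  refine ⟨D, (∑ k ∈ range B, D k ^ 2) / δ, 4 * B / δ * B / δ, by positivity, hD0, hxD,
    fun N => ?_⟩
  have := sum_range_succ_le_of_window_contraction (u := fun k => D k ^ 2)
    (w := fun k => w k ^ 2) (fun _ => sq_nonneg _) (fun _ => sq_nonneg _) (sub_nonneg.2 hδ1)
    (by linarith) (by positivity) hsq N
  refine this.trans (le_of_eq ?_)
  rw [sub_sub_cancel]
  ring

/-- A descent inequality whose error terms are controlled by the dissipation itself. -/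
lemma summable_of_descent {P e c G D : ℕ → ℝ} {K C₀ C₁ : ℝ} (hP : ∀ k, 0 ≤ P k)
    (he : ∀ k, 0 ≤ e k) (hc : ∀ k, 0 ≤ c k) (hG : ∀ k, 0 ≤ G k) (hC₁ : 0 ≤ C₁)
    (hc_sq : Summable fun k => c k ^ 2)
    (hD_sum : ∀ N, ∑ k ∈ range (N + 1), D k ^ 2 ≤ C₀ + C₁ * ∑ k ∈ range N, e k)
    (h : ∀ k, P (k + 1) + e k + 2 * c k * G k ≤ P k + 2 * c k * (K * D (k + 1))) :
    Summable (fun k => c k * G k) ∧ Summable fun k => D k ^ 2 := by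
  set δ : ℝ := 1 / (2 * (C₁ + 1)) with hδ
  have hδ0 : 0 < δ := by positivity
  have hδC : δ * C₁ ≤ 1 / 2 := by
    rw [hδ, div_mul_eq_mul_div, div_le_div_iff₀ (by positivity) two_pos]
    linarith
  have hstep : ∀ k, P (k + 1) + e k + 2 * c k * G k
      ≤ P k + (δ * D (k + 1) ^ 2 + K ^ 2 / δ * c k ^ 2) := by
    intro k
    have h1 : K ^ 2 / δ * c k ^ 2 = δ * (K / δ * c k) ^ 2 := by field_simp
    have h2 : 2 * c k * (K * D (k + 1)) = δ * (2 * D (k + 1) * (K / δ * c k)) := by field_simp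
    have h3 := mul_le_mul_of_nonneg_left (two_mul_le_add_sq (D (k + 1)) (K / δ * c k)) hδ0.le
    have := h k
    rw [h1]
    linarith
  have htel : ∀ N, P N + ∑ k ∈ range N, (e k + 2 * c k * G k)
      ≤ P 0 + ∑ k ∈ range N, (δ * D (k + 1) ^ 2 + K ^ 2 / δ * c k ^ 2) := by
    intro N
    induction N with
    | zero => simp
    | succ N ih =>
      rw [sum_range_succ, sum_range_succ]
      linarith [hstep N]
  set M := P 0 + δ * C₀ + K ^ 2 / δ * ∑' k, c k ^ 2
  have hbound : ∀ N, ∑ k ∈ range N, (e k / 2 + 2 * (c k * G k)) ≤ M := by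
    intro N
    have h1 := htel N
    have h2 : ∑ k ∈ range N, D (k + 1) ^ 2 ≤ ∑ k ∈ range (N + 1), D k ^ 2 := by
      rw [sum_range_succ']
      linarith [sq_nonneg (D 0)]
    have h3 : ∑ k ∈ range N, c k ^ 2 ≤ ∑' k, c k ^ 2 :=
      hc_sq.sum_le_tsum _ fun _ _ => sq_nonneg _
    have h4 := mul_le_mul_of_nonneg_left (h2.trans (hD_sum N)) hδ0.le
    have h5 := mul_le_mul_of_nonneg_left h3 (by positivity : 0 ≤ K ^ 2 / δ)
    have h6 : 0 ≤ ∑ k ∈ range N, e k := sum_nonneg fun _ _ => he _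
    have h7 := mul_le_mul_of_nonneg_right hδC h6
    have h8 := hP N
    rw [sum_add_distrib, sum_add_distrib, ← mul_sum, ← mul_sum] at h1
    simp_rw [mul_assoc, ← mul_sum] at h1
    rw [sum_add_distrib, ← mul_sum, ← sum_div]
    linarith
  have hcG : ∀ k, 0 ≤ c k * G k := fun k => mul_nonneg (hc k) (hG k)
  constructor
  · refine summable_of_sum_range_le (c := M) hcG fun N =>
      (sum_le_sum fun k _ => ?_).trans (hbound N)
    linarith [he k, hcG k]
  · refine summable_of_sum_range_le (c := C₀ + C₁ * (2 * M)) (fun _ => sq_nonneg _) fun N => ?_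
    have h1 : ∑ k ∈ range N, e k ≤ 2 * M := by
      refine le_trans ?_ (mul_le_mul_of_nonneg_left (hbound N) zero_le_two)
      rw [mul_sum]
      exact sum_le_sum fun k _ => by linarith [hcG k]
    calc _ ≤ ∑ k ∈ range (N + 1), D k ^ 2 := by
          rw [sum_range_succ]
          linarith [sq_nonneg (D N)]
      _ ≤ _ := (hD_sum N).trans (by gcongr)

/-- One round of averaging followed by proximal steps does not increase the sum of squared
distances to a common point of the constraint sets, up to the objective gap. -/
lemma sum_proximal_descent {ι : Type*} [Fintype ι] {E : Type*} [NormedAddCommGroup E]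
    [InnerProductSpace ℝ E] {X : ι → Set E} {f : ι → E → ℝ} (hf : ∀ i, ConvexOn ℝ (X i) (f i))
    {a : ι → ι → ℝ} (ha : ∀ i j, 0 ≤ a i j) (ha_row : ∀ i, ∑ j, a i j = 1)
    (ha_col : ∀ j, ∑ i, a i j = 1) {c : ℝ} (hc : 0 < c) {x y : ι → E} (hy : ∀ i, y i ∈ X i)
    (hmin : ∀ i, ∀ q ∈ X i,
      f i (y i) + (1 / (2 * c)) * ‖∑ j, a i j • x j - y i‖ ^ 2
        ≤ f i q + (1 / (2 * c)) * ‖∑ j, a i j • x j - q‖ ^ 2)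
    {p : E} (hp : p ∈ ⋂ i, X i) :
    ∑ i, ‖y i - p‖ ^ 2 + ∑ i, ‖y i - ∑ j, a i j • x j‖ ^ 2
      + 2 * c * (∑ i, f i (y i) - ∑ i, f i p) ≤ ∑ i, ‖x i - p‖ ^ 2 := by
  calc _ = ∑ i, (2 * c * (f i (y i) - f i p) + ‖y i - ∑ j, a i j • x j‖ ^ 2
          + ‖y i - p‖ ^ 2) := by
        simp_rw [sum_add_distrib, ← mul_sum, sum_sub_distrib]
        ring
    _ ≤ ∑ i, ∑ j, a i j * ‖x j - p‖ ^ 2 := sum_le_sum fun i _ =>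
        (proximal_three_point (hf i) hc (hy i) (hmin i) (Set.mem_iInter.1 hp i)).trans
          (norm_sum_smul_sub_sq_le (ha i) (ha_row i) x p)
    _ = _ := by
        rw [sum_comm]
        simp_rw [← sum_mul, ha_col, one_mul]

theorem stmt0
    (n m : ℕ) (hm : 2 ≤ m)
    (X : Fin m → Set (EuclideanSpace ℝ (Fin n)))
    (hXne : ∀ i, (X i).Nonempty)
    (hXcpt : ∀ i, IsCompact (X i))
    (hXconv : ∀ i, Convex ℝ (X i))
    (f : Fin m → EuclideanSpace ℝ (Fin n) → ℝ)
    (hfconv : ∀ i, ConvexOn ℝ Set.univ (f i))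
    (xbar : EuclideanSpace ℝ (Fin n)) (ρ : ℝ) (hρ : 0 < ρ)
    (hball : Metric.ball xbar ρ ⊆ ⋂ i, X i)
    (Xstar : Set (EuclideanSpace ℝ (Fin n)))
    (hXstar : Xstar = {p | p ∈ ⋂ i, X i ∧ ∀ y ∈ ⋂ i, X i, ∑ i, f i p ≤ ∑ i, f i y})
    (hXstar_ne : Xstar.Nonempty)
    (a : ℕ → Fin m → Fin m → ℝ)
    (ha_nonneg : ∀ k i j, 0 ≤ a k i j)
    (ha_row : ∀ k i, ∑ j, a k i j = 1)
    (ha_col : ∀ k j, ∑ i, a k i j = 1)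
    (η : ℝ) (hη : η ∈ Set.Ioo (0:ℝ) 1)
    (ha_diag : ∀ k i, η ≤ a k i i)
    (ha_eta : ∀ k i j, 0 < a k i j → η ≤ a k i j)
    (hconn : ∀ u v : Fin m,
      Relation.ReflTransGen (fun p1 p2 => {k : ℕ | 0 < a k p2 p1}.Infinite) u v)
    (T : ℕ) (hT : 1 ≤ T)
    (hTcomm : ∀ j i : Fin m, {k : ℕ | 0 < a k i j}.Infinite →
      ∀ k : ℕ, ∃ l, k ≤ l ∧ l < k + T ∧ 0 < a l i j)
    (c : ℕ → ℝ) (hc_pos : ∀ k, 0 < c k) (hc_anti : Antitone c)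
    (hc_div : Tendsto (fun N => ∑ k ∈ Finset.range N, c k) atTop atTop)
    (hc_sq : Summable (fun k => (c k)^2))
    (x : Fin m → ℕ → EuclideanSpace ℝ (Fin n))
    (hx0 : ∀ i, x i 0 ∈ X i)
    (z : Fin m → ℕ → EuclideanSpace ℝ (Fin n))
    (hz : ∀ i k, z i k = ∑ j, a k i j • x j k)
    (hupd_mem : ∀ i k, x i (k+1) ∈ X i)
    (hupd_min : ∀ i k, ∀ y ∈ X i,
      f i (x i (k+1)) + (1/(2 * c k)) * ‖z i k - x i (k+1)‖^2
        ≤ f i y + (1/(2 * c k)) * ‖z i k - y‖^2)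
    (hupd_uniq : ∀ i k, ∀ y ∈ X i,
      f i y + (1/(2 * c k)) * ‖z i k - y‖^2
        = f i (x i (k+1)) + (1/(2 * c k)) * ‖z i k - x i (k+1)‖^2 → y = x i (k+1))
    :
    ∃ xstar ∈ Xstar, ∀ i,
      Tendsto (fun k => ‖x i k - xstar‖) atTop (𝓝 0) := by
  have hxX : ∀ k i, x i k ∈ X i := fun k i => by
    cases k with
    | zero => exact hx0 i
    | succ k => exact hupd_mem i k
  simp_rw [hz] at hupd_min
  set F : EuclideanSpace ℝ (Fin n) → ℝ := fun p => ∑ i, f i p with hF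
  set e : ℕ → ℝ := fun k => ∑ i, ‖x i (k + 1) - ∑ j, a k i j • x j k‖ ^ 2 with he
  set P : EuclideanSpace ℝ (Fin n) → ℕ → ℝ := fun p k => ∑ i, ‖x i k - p‖ ^ 2 with hP
  have hP0 : ∀ p k, 0 ≤ P p k := fun p k => sum_nonneg fun _ _ => sq_nonneg _
  have he0 : ∀ k, 0 ≤ e k := fun k => sum_nonneg fun _ _ => sq_nonneg _
  obtain ⟨D, C₀, C₁, hC₁, hD0, hxD, hDsum⟩ := exists_disagreement_bound ha_nonneg ha_row hη
    ha_diag ha_eta hconn hTcomm (w := fun k => √(e k)) (x := x) (fun _ => Real.sqrt_nonneg _)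
    fun i k => Real.le_sqrt_of_sq_le
      (single_le_sum (f := fun i => ‖x i (k + 1) - ∑ j, a k i j • x j k‖ ^ 2)
        (fun _ _ => sq_nonneg _) (mem_univ i))
  simp_rw [Real.sq_sqrt (he0 _)] at hDsum
  -- a common bound for the constraint sets and a common Lipschitz constant on it
  let i₀ : Fin m := ⟨0, by omega⟩
  obtain ⟨R, hR⟩ : ∃ R, ⋃ i, X i ⊆ closedBall 0 R :=
    (isCompact_iUnion hXcpt).isBounded.subset_closedBall 0
  have hXR : ∀ i, X i ⊆ closedBall 0 R := fun i => (Set.subset_iUnion X i).trans hR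
  have hr : closedBall xbar (ρ / 2) ⊆ ⋂ i, X i :=
    (closedBall_subset_ball (by linarith)).trans hball
  have hxbar : ‖xbar‖ ≤ R := by
    simpa using hXR i₀ (Set.mem_iInter.1 (hball (mem_ball_self hρ)) i₀)
  choose L hL0 hL using fun i => (hfconv i).exists_norm_sub_le_closedBall R
  -- feasible points shadowing the iterates
  have hv : ∀ k, ∃ v ∈ ⋂ i, X i, ‖v - x i₀ k‖ ≤ 2 * R / (ρ / 2) * D k := fun k => by
    refine exists_mem_iInter_norm_sub_le hXconv (by linarith) hr (hxX k) (hxD k i₀) (hD0 k) ?_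
    have : ‖x i₀ k‖ ≤ R := by simpa using hXR i₀ (hxX k i₀)
    linarith [norm_sub_le xbar (x i₀ k)]
  choose v hvX hvx using hv
  set K := 1 + 2 * R / (ρ / 2) with hK
  have hxv : ∀ k i, ‖x i k - v k‖ ≤ K * D k := fun k i => by
    have h1 := norm_sub_le_norm_sub_add_norm_sub (x i k) (x i₀ k) (v k)
    have h2 := hvx k
    rw [norm_sub_rev] at h2
    rw [hK, add_mul, one_mul]
    linarith [hxD k i i₀]
  have hFv : ∀ k, F (v k) - ∑ i, f i (x i k) ≤ (∑ i, L i) * K * D k := fun k => by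
    rw [hF, ← sum_sub_distrib, mul_assoc, sum_mul]
    refine sum_le_sum fun i _ => ?_
    calc f i (v k) - f i (x i k) ≤ ‖f i (x i k) - f i (v k)‖ := by
          rw [norm_sub_rev]; exact le_abs_self _
      _ ≤ L i * ‖x i k - v k‖ :=
          hL i _ (hXR i (hxX k i)) _ (hXR i (Set.mem_iInter.1 (hvX k) i))
      _ ≤ _ := mul_le_mul_of_nonneg_left (hxv k i) (hL0 i)
  have hdesc : ∀ p ∈ ⋂ i, X i, ∀ k, P p (k + 1) + e k + 2 * c k * (F (v (k + 1)) - F p)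
      ≤ P p k + 2 * c k * ((∑ i, L i) * K * D (k + 1)) := fun p hp k => by
    have h1 := sum_proximal_descent (fun i => (hfconv i).subset (Set.subset_univ _) (hXconv i))
      (ha_nonneg k) (ha_row k) (ha_col k) (hc_pos k) (fun i => hupd_mem i k)
      (fun i => hupd_min i k) hp
    have h2 := mul_le_mul_of_nonneg_left (hFv (k + 1))
      (mul_nonneg zero_le_two (hc_pos k).le)
    simp only [hP, he, hF] at *
    linarith
  obtain ⟨p₀, hp₀⟩ := hXstar_ne
  rw [hXstar] at hp₀ ⊢
  have hG0 : ∀ k, 0 ≤ F (v (k + 1)) - F p₀ := fun k => sub_nonneg.2 (hp₀.2 _ (hvX _))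
  obtain ⟨hcG, hDsq⟩ := summable_of_descent (hP0 p₀) he0 (fun k => (hc_pos k).le) hG0 hC₁ hc_sq
    hDsum (hdesc p₀ hp₀.1)
  have hDlim : Tendsto D atTop (𝓝 0) := by
    have := (Real.continuous_sqrt.tendsto _).comp hDsq.tendsto_atTop_zero
    simpa [Function.comp_def, Real.sqrt_sq (hD0 _)] using this
  have hcD : Summable fun k => 2 * c k * ((∑ i, L i) * K * D (k + 1)) := by
    have h1 : Summable fun k => c k * D (k + 1) := by
      refine Summable.of_nonneg_of_le (fun k => mul_nonneg (hc_pos k).le (hD0 _)) (fun k => ?_)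
        (hc_sq.add ((summable_nat_add_iff 1).2 hDsq))
      nlinarith [two_mul_le_add_sq (c k) (D (k + 1)), sq_nonneg (c k), sq_nonneg (D (k + 1))]
    refine (h1.mul_left (2 * ((∑ i, L i) * K))).congr fun k => ?_
    ring
  -- a subsequence along which the shadow points converge to a minimizer
  obtain ⟨φ, hφ, hφG⟩ := extraction_forall_of_frequently fun N : ℕ =>
    frequently_lt_of_summable_mul hc_pos hc_div hcG (Nat.one_div_pos_of_nat (α := ℝ) (n := N))
  have hGlim : Tendsto (fun N => F (v (φ N + 1))) atTop (𝓝 (F p₀)) := by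
    have := squeeze_zero (fun N => hG0 (φ N)) (fun N => (hφG N).le)
      tendsto_one_div_add_atTop_nhds_zero_nat
    simpa using this.add_const (F p₀)
  have hcpt : IsCompact (⋂ i, X i) :=
    (hXcpt i₀).of_isClosed_subset (isClosed_iInter fun i => (hXcpt i).isClosed)
      (Set.iInter_subset X i₀)
  obtain ⟨p, hpX, ψ, hψ, hlim⟩ := hcpt.tendsto_subseq fun N => hvX (φ N + 1)
  have hFcont : Continuous F :=
    continuous_finsetSum _ fun i _ => (hfconv i).locallyLipschitz.continuous
  have hFp : F p = F p₀ :=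
    tendsto_nhds_unique ((hFcont.tendsto p).comp hlim) (hGlim.comp hψ.tendsto_atTop)
  have hpmin : ∀ y ∈ ⋂ i, X i, F p ≤ F y := fun y hy => hFp.trans_le (hp₀.2 y hy)
  refine ⟨p, ⟨hpX, hpmin⟩, fun i => ?_⟩
  obtain ⟨l, hl⟩ := exists_tendsto_of_le_add_summable (hP0 p) hcD fun k => by
    have h1 := hdesc p hpX k
    have h2 := mul_nonneg (mul_nonneg zero_le_two (hc_pos k).le)
      (sub_nonneg.2 (hpmin _ (hvX (k + 1))))
    linarith [he0 k]
  have hsub : Tendsto (fun N => φ (ψ N) + 1) atTop atTop :=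
    (tendsto_add_atTop_nat 1).comp (hφ.tendsto_atTop.comp hψ.tendsto_atTop)
  have hPsub : Tendsto (fun N => P p (φ (ψ N) + 1)) atTop (𝓝 0) := by
    rw [← sum_const_zero (s := (univ : Finset (Fin m)))]
    refine tendsto_finsetSum _ fun j _ => ?_
    have h1 : Tendsto (fun N => ‖x j (φ (ψ N) + 1) - p‖) atTop (𝓝 0) := by
      have h2 := ((hDlim.comp hsub).const_mul K).add (tendsto_iff_norm_sub_tendsto_zero.1 hlim)
      rw [mul_zero, add_zero] at h2
      refine squeeze_zero (fun _ => norm_nonneg _) (fun N => ?_) h2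
      exact (norm_sub_le_norm_sub_add_norm_sub _ (v (φ (ψ N) + 1)) _).trans
        (add_le_add_left (hxv _ _) _)
    simpa using h1.pow 2
  have hl0 : l = 0 := tendsto_nhds_unique (hl.comp hsub) hPsub
  rw [hl0] at hl
  have hsqrt := (Real.continuous_sqrt.tendsto _).comp hl
  rw [Real.sqrt_zero] at hsqrt
  exact squeeze_zero (fun _ => norm_nonneg _) (fun k => Real.le_sqrt_of_sq_le
    (single_le_sum (f := fun i => ‖x i k - p‖ ^ 2) (fun _ _ => sq_nonneg _) (mem_univ i))) hsqrt
end

section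
/- Under the full assumptions and Algorithm 1, for every minimizer x* ∈ X* and every i = 1,…,m, the real sequence {‖x_i(k) − x*‖}_{k ≥ 0} is convergent. -/
open Filter Finset Metric
open scoped Topology BigOperators

section InnerProductSpace

variable {E : Type*} [NormedAddCommGroup E] [InnerProductSpace ℝ E]

/-- The three-point inequality for a proximal step over a convex set. -/
theorem prox_three_point_inequality {X : Set E} (hX : Convex ℝ X) {f : E → ℝ}
    (hf : ConvexOn ℝ Set.univ f) {c : ℝ} (hc : 0 < c) {z p : E} (hp : p ∈ X)
    (hmin : ∀ y ∈ X,
      f p + (1 / (2 * c)) * ‖z - p‖ ^ 2 ≤ f y + (1 / (2 * c)) * ‖z - y‖ ^ 2)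
    {y : E} (hy : y ∈ X) :
    ‖p - y‖ ^ 2 + ‖p - z‖ ^ 2 ≤ ‖z - y‖ ^ 2 + 2 * c * (f y - f p) := by
  have key : ∀ t : ℝ, 0 < t → t ≤ 1 →
      0 ≤ (2 * c * (f y - f p) - 2 * inner ℝ (z - p) (y - p)) + t * ‖y - p‖ ^ 2 := by
    intro t ht ht1
    have hmem : (1 - t) • p + t • y ∈ X := hX hp hy (by linarith) ht.le (by ring)
    have h1 := hmin _ hmem
    have h2 := hf.2 (Set.mem_univ p) (Set.mem_univ y) (by linarith : 0 ≤ 1 - t) ht.le (by ring)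
    have h3 : z - ((1 - t) • p + t • y) = (z - p) - t • (y - p) := by module
    have h4 : ‖z - ((1 - t) • p + t • y)‖ ^ 2
        = ‖z - p‖ ^ 2 - 2 * (t * inner ℝ (z - p) (y - p)) + t ^ 2 * ‖y - p‖ ^ 2 := by
      rw [h3, norm_sub_sq_real, inner_smul_right, norm_smul, mul_pow, Real.norm_eq_abs, sq_abs]
    rw [h4] at h1
    simp only [smul_eq_mul] at h2
    have h5 : 0 ≤ t * (f y - f p) + (1 / (2 * c)) *
        (- 2 * (t * inner ℝ (z - p) (y - p)) + t ^ 2 * ‖y - p‖ ^ 2) := by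
      linarith
    have h6 := mul_nonneg (by positivity : 0 ≤ 2 * c) h5
    have h7 : 2 * c * (t * (f y - f p) + (1 / (2 * c)) *
        (- 2 * (t * inner ℝ (z - p) (y - p)) + t ^ 2 * ‖y - p‖ ^ 2))
        = t * ((2 * c * (f y - f p) - 2 * inner ℝ (z - p) (y - p)) + t * ‖y - p‖ ^ 2) := by
      field_simp
      ring
    rw [h7] at h6
    exact nonneg_of_mul_nonneg_right h6 ht
  have hlim : 0 ≤ 2 * c * (f y - f p) - 2 * inner ℝ (z - p) (y - p) := by
    have ht : Tendsto (fun t : ℝ => (2 * c * (f y - f p) - 2 * inner ℝ (z - p) (y - p))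
        + t * ‖y - p‖ ^ 2) (𝓝[>] 0)
        (𝓝 ((2 * c * (f y - f p) - 2 * inner ℝ (z - p) (y - p)) + 0 * ‖y - p‖ ^ 2)) :=
      (Continuous.tendsto (by fun_prop) 0).mono_left nhdsWithin_le_nhds
    rw [zero_mul, add_zero] at ht
    refine ge_of_tendsto ht ?_
    filter_upwards [Ioc_mem_nhdsGT (zero_lt_one' ℝ)] with t ht
    exact key t ht.1 ht.2
  have h8 : ‖z - y‖ ^ 2 = ‖z - p‖ ^ 2 - 2 * inner ℝ (z - p) (y - p) + ‖y - p‖ ^ 2 := by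
    rw [← norm_sub_sq_real, sub_sub_sub_cancel_right]
  rw [norm_sub_rev p y, norm_sub_rev p z]
  linarith

variable {ι : Type*} [Fintype ι]

/-- Bias-variance decomposition around a weighted average. -/
theorem sum_mul_norm_sub_sq_eq {w : ι → ℝ} (hw : ∑ j, w j = 1) (x : ι → E) (y : E) :
    ∑ j, w j * ‖x j - y‖ ^ 2
      = ∑ j, w j * ‖x j - ∑ l, w l • x l‖ ^ 2 + ‖(∑ l, w l • x l) - y‖ ^ 2 := by
  set z := ∑ l, w l • x l with hz
  have h1 : ∀ j, w j * ‖x j - y‖ ^ 2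
      = w j * ‖x j - z‖ ^ 2 + 2 * inner ℝ (w j • (x j - z)) (z - y) + w j * ‖z - y‖ ^ 2 := by
    intro j
    rw [← sub_add_sub_cancel (x j) z y, norm_add_sq_real, real_inner_smul_left]
    ring
  have h2 : ∑ j, w j • (x j - z) = 0 := by
    simp only [smul_sub, sum_sub_distrib, ← sum_smul, hw, one_smul, ← hz, sub_self]
  simp only [h1, sum_add_distrib, ← mul_sum, ← sum_inner, h2, ← sum_mul, hw, inner_zero_left]
  ring

theorem norm_average_sub_sq_le {w : ι → ℝ} (hw0 : ∀ j, 0 ≤ w j) (hw : ∑ j, w j = 1)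
    (x : ι → E) (y : E) :
    ‖(∑ l, w l • x l) - y‖ ^ 2 ≤ ∑ j, w j * ‖x j - y‖ ^ 2 := by
  rw [sum_mul_norm_sub_sq_eq hw]
  exact le_add_of_nonneg_left (sum_nonneg fun j _ => mul_nonneg (hw0 j) (sq_nonneg _))

/-- Averaging strictly decreases the mean square distance to a point, by an amount controlling the
spread around any point carrying a weight at least `η`. -/
theorem norm_average_sub_sq_add_le {w : ι → ℝ} (hw0 : ∀ j, 0 ≤ w j) (hw : ∑ j, w j = 1)
    {η : ℝ} (hη1 : η ≤ 1) {i : ι} (hi : η ≤ w i) (x : ι → E) (y : E) :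
    ‖(∑ l, w l • x l) - y‖ ^ 2 + η / 2 * ∑ j, w j * ‖x j - x i‖ ^ 2
      ≤ ∑ j, w j * ‖x j - y‖ ^ 2 := by
  rw [sum_mul_norm_sub_sq_eq hw x y, sum_mul_norm_sub_sq_eq hw x (x i)]
  set z := ∑ l, w l • x l
  have h1 : w i * ‖x i - z‖ ^ 2 ≤ ∑ j, w j * ‖x j - z‖ ^ 2 :=
    single_le_sum (f := fun j => w j * ‖x j - z‖ ^ 2)
      (fun j _ => mul_nonneg (hw0 j) (sq_nonneg _)) (mem_univ i)
  have h2 : η * ‖z - x i‖ ^ 2 ≤ w i * ‖x i - z‖ ^ 2 := by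
    rw [norm_sub_rev z]
    gcongr
  have h3 : 0 ≤ ∑ j, w j * ‖x j - z‖ ^ 2 :=
    sum_nonneg fun j _ => mul_nonneg (hw0 j) (sq_nonneg _)
  nlinarith

end InnerProductSpace

section RealSequences

/-- A descent inequality with error `c k * R (k + 1)`, whose residual `R` is controlled over a
bounded window by the decrease `G`. -/
theorem tendsto_of_descent_of_window {S G R c : ℕ → ℝ} {β L C M : ℝ} {T : ℕ}
    (hS : ∀ k, 0 ≤ S k) (hG0 : ∀ k, 0 ≤ G k) (hGM : ∀ k, G k ≤ M) (hR : ∀ k, 0 ≤ R k)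
    (hc : ∀ k, 0 ≤ c k) (hβ : 0 < β) (hL : 0 ≤ L) (hC : 0 ≤ C)
    (hdesc : ∀ k, S (k + 1) + β * G k ≤ S k + L * (c k * R (k + 1)))
    (hwin : ∀ k, R k ^ 2 ≤ C * ∑ r ∈ range T, G (k + r))
    (hcs : Summable fun k => c k ^ 2) :
    Tendsto R atTop (𝓝 0) ∧ ∃ l, Tendsto S atTop (𝓝 l) := by
  have hM : 0 ≤ M := (hG0 0).trans (hGM 0)
  have hshift : ∀ N s : ℕ, ∑ k ∈ range N, G (k + s) ≤ ∑ k ∈ range N, G k + s * M := by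
    intro N s
    have h1 : ∑ k ∈ range N, G (k + s) ≤ ∑ k ∈ range (N + s), G k := by
      rw [add_comm N s, sum_range_add]
      simp only [add_comm s]
      exact le_add_of_nonneg_left (sum_nonneg fun k _ => hG0 k)
    have h2 : ∑ k ∈ range s, G (N + k) ≤ s * M := by
      simpa using sum_le_card_nsmul (range s) (fun k => G (N + k)) M fun k _ => hGM _
    rw [sum_range_add] at h1
    linarith
  have hRsum : ∀ N : ℕ, ∑ k ∈ range N, R (k + 1) ^ 2
      ≤ C * (T * (∑ k ∈ range N, G k + (T + 1) * M)) := by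
    intro N
    calc ∑ k ∈ range N, R (k + 1) ^ 2
        ≤ ∑ k ∈ range N, C * ∑ r ∈ range T, G (k + (1 + r)) := by
          refine sum_le_sum fun k _ => ?_
          simpa only [add_assoc] using hwin (k + 1)
      _ = C * ∑ r ∈ range T, ∑ k ∈ range N, G (k + (1 + r)) := by
          rw [← mul_sum, sum_comm]
      _ ≤ C * ∑ r ∈ range T, (∑ k ∈ range N, G k + (T + 1) * M) := by
          refine mul_le_mul_of_nonneg_left (sum_le_sum fun r hr => (hshift N (1 + r)).trans ?_) hC
          have : (r : ℝ) ≤ T := by exact_mod_cast (mem_range.mp hr).le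
          push_cast
          rw [add_comm (1 : ℝ)]
          gcongr
      _ = _ := by rw [sum_const, card_range, nsmul_eq_mul]
  have hdescsum : ∀ N : ℕ, S N + β * ∑ k ∈ range N, G k
      ≤ S 0 + L * ∑ k ∈ range N, c k * R (k + 1) := by
    intro N
    induction N with
    | zero => simp
    | succ N ih =>
      rw [sum_range_succ, sum_range_succ]
      linarith [hdesc N]
  obtain ⟨α, hα, hαβ⟩ : ∃ α : ℝ, 0 < α ∧ α * (C * T) ≤ β / 2 := by
    refine ⟨β / 2 / (C * T + 1), by positivity, ?_⟩
    rw [div_mul_eq_mul_div, div_le_iff₀ (by positivity)]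
    nlinarith
  have hyoung : ∀ k, L * (c k * R (k + 1)) ≤ L ^ 2 / (4 * α) * c k ^ 2 + α * R (k + 1) ^ 2 := by
    intro k
    have h : L ^ 2 / (4 * α) * c k ^ 2 + α * R (k + 1) ^ 2 - L * (c k * R (k + 1))
        = (L * c k - 2 * α * R (k + 1)) ^ 2 / (4 * α) := by
      field_simp
      ring
    have : 0 ≤ (L * c k - 2 * α * R (k + 1)) ^ 2 / (4 * α) := by positivity
    linarith
  have hGsum : Summable G := by
    refine summable_of_sum_range_le (c := (S 0 + L ^ 2 / (4 * α) * (∑' k, c k ^ 2)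
      + α * (C * T) * ((T + 1) * M)) / (β / 2)) hG0 fun N => ?_
    rw [le_div_iff₀ (by positivity)]
    have h1 : L * ∑ k ∈ range N, c k * R (k + 1)
        ≤ L ^ 2 / (4 * α) * ∑ k ∈ range N, c k ^ 2 + α * ∑ k ∈ range N, R (k + 1) ^ 2 := by
      rw [mul_sum, mul_sum, mul_sum, ← sum_add_distrib]
      exact sum_le_sum fun k _ => hyoung k
    have h2 : L ^ 2 / (4 * α) * ∑ k ∈ range N, c k ^ 2 ≤ L ^ 2 / (4 * α) * ∑' k, c k ^ 2 :=
      mul_le_mul_of_nonneg_left (hcs.sum_le_tsum _ fun k _ => sq_nonneg _) (by positivity)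
    have h3 := mul_le_mul_of_nonneg_left (hRsum N) hα.le
    have h4 := mul_le_mul_of_nonneg_right hαβ (sum_nonneg fun k (_ : k ∈ range N) => hG0 k)
    linarith [hdescsum N, hS N]
  have hR2 : Summable fun k => R (k + 1) ^ 2 := by
    refine summable_of_sum_range_le (c := C * (T * (∑' k, G k + (T + 1) * M)))
      (fun k => sq_nonneg _) fun N => (hRsum N).trans ?_
    gcongr
    exact hGsum.sum_le_tsum _ fun k _ => hG0 k
  have hcR : Summable fun k => L * (c k * R (k + 1)) :=
    Summable.of_nonneg_of_le (fun k => mul_nonneg hL (mul_nonneg (hc k) (hR _))) hyoung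
      ((hcs.mul_left _).add (hR2.mul_left _))
  constructor
  · have h := (Real.continuous_sqrt.tendsto 0).comp hR2.tendsto_atTop_zero
    rw [Real.sqrt_zero] at h
    refine (tendsto_add_atTop_iff_nat 1).mp (h.congr fun k => ?_)
    exact Real.sqrt_sq (hR _)
  · set U : ℕ → ℝ := fun k => S k - ∑ j ∈ range k, L * (c j * R (j + 1)) with hU
    have hanti : Antitone U := by
      refine antitone_nat_of_succ_le fun k => ?_
      simp only [hU, sum_range_succ]
      linarith [hdesc k, mul_nonneg hβ.le (hG0 k)]
    have hbdd : BddBelow (Set.range U) := by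
      refine ⟨-∑' j, L * (c j * R (j + 1)), ?_⟩
      rintro _ ⟨k, rfl⟩
      have := hcR.sum_le_tsum (range k) fun j _ => mul_nonneg hL (mul_nonneg (hc j) (hR _))
      simp only [hU]
      linarith [hS k]
    refine ⟨_, ((tendsto_atTop_ciInf hanti hbdd).add hcR.hasSum.tendsto_sum_nat).congr fun k => ?_⟩
    simp [hU]

/-- If the squares of finitely many bounded sequences have a convergent sum and the sequences
asymptotically agree, then each of them converges. -/
theorem tendsto_of_tendsto_sum_sq {ι : Type*} [Fintype ι] [Nonempty ι] {d : ι → ℕ → ℝ} {D l : ℝ}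
    (hd0 : ∀ i k, 0 ≤ d i k) (hdD : ∀ i k, d i k ≤ D)
    (hdiff : ∀ i j, Tendsto (fun k => d i k - d j k) atTop (𝓝 0))
    (hsum : Tendsto (fun k => ∑ j, d j k ^ 2) atTop (𝓝 l)) (i : ι) :
    ∃ L, Tendsto (d i) atTop (𝓝 L) := by
  have h1 : ∀ j, Tendsto (fun k => (d i k - d j k) * (d i k + d j k)) atTop (𝓝 0) := by
    intro j
    refine (hdiff i j).zero_mul_isBoundedUnder_le ?_
    refine isBoundedUnder_of ⟨D + D, fun k => ?_⟩
    simp only [Function.comp_apply, Real.norm_eq_abs]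
    rw [abs_of_nonneg (add_nonneg (hd0 i k) (hd0 j k))]
    exact add_le_add (hdD i k) (hdD j k)
  have h2 := (tendsto_finsetSum univ fun j _ => h1 j).add hsum
  have hcard : (Fintype.card ι : ℝ) ≠ 0 := by
    exact_mod_cast Fintype.card_ne_zero
  have h3 : Tendsto (fun k => d i k ^ 2) atTop (𝓝 (((∑ _j : ι, (0 : ℝ)) + l) / Fintype.card ι)) := by
    refine (h2.div_const (Fintype.card ι : ℝ)).congr fun k => ?_
    rw [← sum_add_distrib, div_eq_iff hcard]
    have : ∀ j, (d i k - d j k) * (d i k + d j k) + d j k ^ 2 = d i k ^ 2 := fun j => by ring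
    simp only [this, sum_const, card_univ, nsmul_eq_mul]
    exact mul_comm _ _
  exact ⟨_, h3.sqrt.congr fun k => Real.sqrt_sq (hd0 i k)⟩

end RealSequences

section Feasibility

variable {E : Type*} [NormedAddCommGroup E] [NormedSpace ℝ E] {ι : Type*}

/-- Moving a point towards the center of a ball contained in all the convex sets `X j` produces
a common point, at a distance proportional to the disagreement of the points `x j ∈ X j`. -/
theorem exists_common_mem_norm_sub_le {X : ι → Set E} (hX : ∀ i, Convex ℝ (X i)) {o : E} {ρ : ℝ}
    (hρ : 0 < ρ) (hball : ∀ i, ball o ρ ⊆ X i) {x : ι → E} (hx : ∀ i, x i ∈ X i) (v : E)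
    {ε : ℝ} (hε : 0 ≤ ε) (hxv : ∀ j, ‖v - x j‖ ≤ ε) :
    ∃ q, (∀ j, q ∈ X j) ∧ ‖q - v‖ ≤ 2 / ρ * ε * ‖o - v‖ := by
  have hpos : 0 < ε + ρ / 2 := by positivity
  have hsum : ρ / 2 / (ε + ρ / 2) + ε / (ε + ρ / 2) = 1 := by
    rw [← add_div, add_comm, div_self hpos.ne']
  refine ⟨(ρ / 2 / (ε + ρ / 2)) • v + (ε / (ε + ρ / 2)) • o, fun j => ?_, ?_⟩
  · have hy : o + (ρ / 2 / ε) • (v - x j) ∈ X j := by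
      refine hball j ?_
      rw [mem_ball_iff_norm, add_sub_cancel_left, norm_smul, Real.norm_of_nonneg (by positivity)]
      calc ρ / 2 / ε * ‖v - x j‖ ≤ ρ / 2 / ε * ε := by gcongr; exact hxv j
        _ ≤ ρ / 2 := by
          rw [div_mul_eq_mul_div]
          exact div_le_of_le_mul₀ hε (by positivity) le_rfl
        _ < ρ := by linarith
    have hconv := hX j (hx j) hy (by positivity : 0 ≤ ρ / 2 / (ε + ρ / 2))
      (by positivity : 0 ≤ ε / (ε + ρ / 2)) hsum
    convert hconv using 1
    rcases hε.eq_or_lt with rfl | hε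
    · have : v - x j = 0 := norm_le_zero_iff.mp (hxv j)
      rw [sub_eq_zero.mp this]
      simp
    · have h : ε / (ε + ρ / 2) * (ρ / 2 / ε) = ρ / 2 / (ε + ρ / 2) := by field_simp
      rw [smul_add, smul_smul, h]
      module
  · have h : (ρ / 2 / (ε + ρ / 2)) • v + (ε / (ε + ρ / 2)) • o - v
        = (ε / (ε + ρ / 2)) • (o - v) := by
      rw [← eq_sub_iff_add_eq] at hsum
      rw [hsum]
      module
    rw [h, norm_smul, Real.norm_of_nonneg (by positivity)]
    gcongr
    rw [div_le_iff₀ hpos]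
    have : 2 / ρ * ε * (ε + ρ / 2) = ε + 2 / ρ * ε * ε := by field_simp; ring
    rw [this]
    exact le_add_of_nonneg_right (by positivity)

/-- At points `x i ∈ X i`, the amount by which `∑ i, f i (x i)` may fall below the minimum of
`∑ i, f i` over `⋂ i, X i` is bounded by a multiple of the disagreement of the points. -/
theorem exists_sum_sub_le_mul_disagreement [Fintype ι] [Nonempty ι] [FiniteDimensional ℝ E]
    {X : ι → Set E} (hXcpt : ∀ i, IsCompact (X i)) (hX : ∀ i, Convex ℝ (X i)) {f : ι → E → ℝ}
    (hf : ∀ i, ConvexOn ℝ Set.univ (f i)) {o : E} {ρ : ℝ} (hρ : 0 < ρ)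
    (hball : ∀ i, ball o ρ ⊆ X i) {p : E}
    (hmin : ∀ y, (∀ i, y ∈ X i) → ∑ i, f i p ≤ ∑ i, f i y) :
    ∃ L, 0 ≤ L ∧ ∀ x : ι → E, (∀ i, x i ∈ X i) →
      ∑ i, (f i p - f i (x i)) ≤ L * ∑ i, ∑ j, ‖x i - x j‖ := by
  have hKcpt : IsCompact (⋃ i, X i) := isCompact_iUnion hXcpt
  have hlip : ∀ i, ∃ K, LipschitzOnWith K (f i) (⋃ i, X i) := fun i =>
    (hf i).locallyLipschitz.locallyLipschitzOn.exists_lipschitzOnWith_of_compact hKcpt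
  choose K hK using hlip
  obtain ⟨D, hD0, hD⟩ := hKcpt.isBounded.exists_pos_norm_le
  have hsub : ∀ i, X i ⊆ ⋃ i, X i := fun i => Set.subset_iUnion X i
  let i₀ : ι := Classical.arbitrary ι
  have hmem_o : o ∈ ⋃ i, X i := hsub i₀ (hball i₀ (mem_ball_self hρ))
  refine ⟨∑ i, (K i : ℝ) * (2 / ρ * (2 * D) + 1), by positivity, fun x hx => ?_⟩
  set ε := ∑ i, ∑ j, ‖x i - x j‖ with hεdef
  have hε : 0 ≤ ε := by positivity
  have hxv : ∀ j, ‖x i₀ - x j‖ ≤ ε := fun j =>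
    (single_le_sum (f := fun j => ‖x i₀ - x j‖) (fun _ _ => norm_nonneg _) (mem_univ j)).trans
      (single_le_sum (f := fun i => ∑ j, ‖x i - x j‖)
        (fun _ _ => sum_nonneg fun _ _ => norm_nonneg _) (mem_univ i₀))
  obtain ⟨q, hq, hqv⟩ := exists_common_mem_norm_sub_le hX hρ hball hx (x i₀) hε hxv
  have hov : ‖o - x i₀‖ ≤ 2 * D := by
    linarith [norm_sub_le o (x i₀), hD o hmem_o, hD _ (hsub i₀ (hx i₀))]
  rw [sum_sub_distrib, sum_mul]
  refine (sub_le_sub_right (hmin q hq) _).trans ?_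
  rw [← sum_sub_distrib]
  refine sum_le_sum fun i _ => ?_
  have hdist := (hK i).dist_le_mul q (hsub i (hq i)) (x i) (hsub i (hx i))
  rw [dist_eq_norm, dist_eq_norm] at hdist
  have hqx : ‖q - x i‖ ≤ (2 / ρ * (2 * D) + 1) * ε := by
    calc ‖q - x i‖ ≤ ‖q - x i₀‖ + ‖x i₀ - x i‖ := norm_sub_le_norm_sub_add_norm_sub _ _ _
      _ ≤ 2 / ρ * ε * (2 * D) + ε := by
        refine add_le_add (hqv.trans ?_) (hxv i)
        gcongr
      _ = _ := by ring
  calc f i q - f i (x i) ≤ ‖f i q - f i (x i)‖ := Real.le_norm_self _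
    _ ≤ K i * ‖q - x i‖ := hdist
    _ ≤ K i * ((2 / ρ * (2 * D) + 1) * ε) := by gcongr
    _ = _ := by ring

end Feasibility

section Disagreement

variable {E : Type*} [NormedAddCommGroup E] [InnerProductSpace ℝ E] {ι : Type*} [Fintype ι]

/-- The squared displacements away from the weighted averages, plus the weighted squared
disagreement along the edges in use at time `k`. -/
noncomputable def stepResidual (a : ℕ → ι → ι → ℝ) (x : ι → ℕ → E) (k : ℕ) : ℝ :=
  ∑ i, ‖x i (k + 1) - ∑ j, a k i j • x j k‖ ^ 2 + ∑ i, ∑ j, a k i j * ‖x j k - x i k‖ ^ 2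

theorem stepResidual_nonneg {a : ℕ → ι → ι → ℝ} (ha : ∀ k i j, 0 ≤ a k i j) (x : ι → ℕ → E)
    (k : ℕ) : 0 ≤ stepResidual a x k :=
  add_nonneg (sum_nonneg fun _ _ => sq_nonneg _)
    (sum_nonneg fun _ _ => sum_nonneg fun _ _ => mul_nonneg (ha _ _ _) (sq_nonneg _))

theorem sum_mul_norm_sub_sq_le_stepResidual {a : ℕ → ι → ι → ℝ} (ha : ∀ k i j, 0 ≤ a k i j)
    (x : ι → ℕ → E) (k : ℕ) (i : ι) :
    ∑ j, a k i j * ‖x j k - x i k‖ ^ 2 ≤ stepResidual a x k :=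
  (single_le_sum (f := fun i => ∑ j, a k i j * ‖x j k - x i k‖ ^ 2)
    (fun _ _ => sum_nonneg fun _ _ => mul_nonneg (ha _ _ _) (sq_nonneg _)) (mem_univ i)).trans
    (le_add_of_nonneg_left (sum_nonneg fun _ _ => sq_nonneg _))

theorem norm_succ_sub_le_sqrt_stepResidual {a : ℕ → ι → ι → ℝ} (ha : ∀ k i j, 0 ≤ a k i j)
    (harow : ∀ k i, ∑ j, a k i j = 1) (x : ι → ℕ → E) (k : ℕ) (i : ι) :
    ‖x i (k + 1) - x i k‖ ≤ 2 * √(stepResidual a x k) := by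
  have h1 : ‖x i (k + 1) - ∑ j, a k i j • x j k‖ ≤ √(stepResidual a x k) := by
    refine Real.le_sqrt_of_sq_le ?_
    refine (single_le_sum (f := fun i => ‖x i (k + 1) - ∑ j, a k i j • x j k‖ ^ 2)
      (fun _ _ => sq_nonneg _) (mem_univ i)).trans (le_add_of_nonneg_right ?_)
    exact sum_nonneg fun _ _ => sum_nonneg fun _ _ => mul_nonneg (ha _ _ _) (sq_nonneg _)
  have h2 : ‖(∑ j, a k i j • x j k) - x i k‖ ≤ √(stepResidual a x k) :=
    Real.le_sqrt_of_sq_le <| (norm_average_sub_sq_le (ha k i) (harow k i) _ _).trans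
      (sum_mul_norm_sub_sq_le_stepResidual ha x k i)
  linarith [norm_sub_le_norm_sub_add_norm_sub (x i (k + 1)) (∑ j, a k i j • x j k) (x i k)]

/-- Under bounded intercommunication intervals and strong connectivity, the disagreement at time
`k` is controlled by the residuals of the next `T` steps. -/
theorem exists_disagreement_sq_le {a : ℕ → ι → ι → ℝ} (ha : ∀ k i j, 0 ≤ a k i j)
    (harow : ∀ k i, ∑ j, a k i j = 1) {η : ℝ} (hη : 0 < η)
    (haη : ∀ k i j, 0 < a k i j → η ≤ a k i j)
    (hconn : ∀ u v : ι, Relation.ReflTransGen (fun p q => {k : ℕ | 0 < a k q p}.Infinite) u v)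
    {T : ℕ} (hT : ∀ j i : ι, {k : ℕ | 0 < a k i j}.Infinite →
      ∀ k : ℕ, ∃ l, k ≤ l ∧ l < k + T ∧ 0 < a l i j) (x : ι → ℕ → E) :
    ∃ C, 0 ≤ C ∧ ∀ k, (∑ i, ∑ j, ‖x i k - x j k‖) ^ 2
      ≤ C * ∑ r ∈ range T, stepResidual a x (k + r) := by
  set g : ℕ → ℝ := fun k => ∑ r ∈ range T, √(stepResidual a x (k + r)) with hg
  have hg0 : ∀ k, 0 ≤ g k := fun k => sum_nonneg fun _ _ => Real.sqrt_nonneg _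
  have hdrift : ∀ (i : ι) (k s : ℕ), s ≤ T → ‖x i (k + s) - x i k‖ ≤ 2 * g k := by
    intro i k s hs
    have h := norm_sum_le (range s) fun r => x i (k + (r + 1)) - x i (k + r)
    rw [sum_range_sub fun r => x i (k + r)] at h
    calc ‖x i (k + s) - x i k‖ ≤ ∑ r ∈ range s, ‖x i (k + (r + 1)) - x i (k + r)‖ := h
      _ ≤ ∑ r ∈ range s, 2 * √(stepResidual a x (k + r)) :=
        sum_le_sum fun r _ => norm_succ_sub_le_sqrt_stepResidual ha harow x (k + r) i
      _ ≤ ∑ r ∈ range T, 2 * √(stepResidual a x (k + r)) :=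
        sum_le_sum_of_subset_of_nonneg (range_mono hs) fun _ _ _ => by positivity
      _ = 2 * g k := by rw [mul_sum]
  have hedge : ∀ p q : ι, {k : ℕ | 0 < a k q p}.Infinite → ∀ k,
      ‖x p k - x q k‖ ≤ (√η⁻¹ + 4) * g k := by
    intro p q hpq k
    obtain ⟨l, hkl, hlT, hal⟩ := hT p q hpq k
    obtain ⟨s, rfl⟩ := Nat.exists_eq_add_of_le hkl
    have hs : s < T := by omega
    have h1 : η * ‖x p (k + s) - x q (k + s)‖ ^ 2 ≤ stepResidual a x (k + s) := by
      refine le_trans ?_ (sum_mul_norm_sub_sq_le_stepResidual ha x (k + s) q)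
      refine le_trans ?_ (single_le_sum
        (f := fun j => a (k + s) q j * ‖x j (k + s) - x q (k + s)‖ ^ 2)
        (fun _ _ => mul_nonneg (ha _ _ _) (sq_nonneg _)) (mem_univ p))
      exact mul_le_mul_of_nonneg_right (haη _ _ _ hal) (sq_nonneg _)
    have h2 : ‖x p (k + s) - x q (k + s)‖ ≤ √η⁻¹ * √(stepResidual a x (k + s)) := by
      rw [← Real.sqrt_mul (inv_nonneg.mpr hη.le)]
      refine Real.le_sqrt_of_sq_le ?_
      rwa [← div_eq_inv_mul, le_div_iff₀' hη]
    have h3 : √(stepResidual a x (k + s)) ≤ g k :=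
      single_le_sum (f := fun r => √(stepResidual a x (k + r))) (fun _ _ => Real.sqrt_nonneg _)
        (mem_range.mpr hs)
    have h4 := mul_le_mul_of_nonneg_left h3 (Real.sqrt_nonneg η⁻¹)
    have h5 := norm_sub_le_norm_sub_add_norm_sub (x p k) (x p (k + s)) (x q k)
    have h6 := norm_sub_le_norm_sub_add_norm_sub (x p (k + s)) (x q (k + s)) (x q k)
    rw [norm_sub_rev (x p k) (x p (k + s))] at h5
    linarith [hdrift p k s hs.le, hdrift q k s hs.le]
  have hpair : ∀ u v : ι, ∃ B, 0 ≤ B ∧ ∀ k, ‖x u k - x v k‖ ≤ B * g k := by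
    intro u v
    induction hconn u v with
    | refl => exact ⟨0, le_rfl, fun k => by simp⟩
    | tail _ hpq ih =>
      obtain ⟨B, hB, ih⟩ := ih
      refine ⟨B + (√η⁻¹ + 4), by positivity, fun k => ?_⟩
      rw [add_mul]
      exact (norm_sub_le_norm_sub_add_norm_sub _ _ _).trans (add_le_add (ih k) (hedge _ _ hpq k))
  choose B hB0 hB using hpair
  refine ⟨(∑ i, ∑ j, B i j) ^ 2 * T, by positivity, fun k => ?_⟩
  have h1 : ∑ i, ∑ j, ‖x i k - x j k‖ ≤ (∑ i, ∑ j, B i j) * g k := by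
    simp only [sum_mul]
    exact sum_le_sum fun i _ => sum_le_sum fun j _ => hB i j k
  have h2 : g k ^ 2 ≤ T * ∑ r ∈ range T, stepResidual a x (k + r) := by
    have h := sq_sum_le_card_mul_sum_sq (s := range T)
      (f := fun r => √(stepResidual a x (k + r)))
    simpa only [card_range, Real.sq_sqrt (stepResidual_nonneg ha x _)] using h
  calc (∑ i, ∑ j, ‖x i k - x j k‖) ^ 2 ≤ ((∑ i, ∑ j, B i j) * g k) ^ 2 :=
        pow_le_pow_left₀ (by positivity) h1 2
    _ = (∑ i, ∑ j, B i j) ^ 2 * g k ^ 2 := mul_pow _ _ _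
    _ ≤ (∑ i, ∑ j, B i j) ^ 2 * (T * ∑ r ∈ range T, stepResidual a x (k + r)) := by gcongr
    _ = _ := by ring

theorem exists_stepResidual_le {a : ℕ → ι → ι → ℝ} (ha : ∀ k i j, 0 ≤ a k i j)
    (harow : ∀ k i, ∑ j, a k i j = 1) {x : ι → ℕ → E} {D : ℝ} (hD : ∀ i k, ‖x i k‖ ≤ D) :
    ∃ M, ∀ k, stepResidual a x k ≤ M := by
  have hpair : ∀ i j k l, ‖x i k - x j l‖ ^ 2 ≤ (2 * D) ^ 2 := fun i j k l =>
    pow_le_pow_left₀ (norm_nonneg _)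
      (by linarith [norm_sub_le (x i k) (x j l), hD i k, hD j l]) 2
  have hrow : ∀ i k, ∀ y : ι → ℝ, (∀ j, y j ≤ (2 * D) ^ 2) →
      ∑ j, a k i j * y j ≤ (2 * D) ^ 2 := fun i k y hy => by
    calc ∑ j, a k i j * y j ≤ ∑ j, a k i j * (2 * D) ^ 2 :=
          sum_le_sum fun j _ => mul_le_mul_of_nonneg_left (hy j) (ha k i j)
      _ = (2 * D) ^ 2 := by rw [← sum_mul, harow, one_mul]
  refine ⟨∑ _i : ι, (2 * D) ^ 2 + ∑ _i : ι, (2 * D) ^ 2, fun k => add_le_add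
    (sum_le_sum fun i _ => ?_) (sum_le_sum fun i _ => hrow i k _ fun j => hpair j i k k)⟩
  rw [norm_sub_rev]
  exact (norm_average_sub_sq_le (ha k i) (harow k i) _ _).trans
    (hrow i k _ fun j => hpair j i k (k + 1))

end Disagreement

theorem stmt1
    (n m : ℕ) (hm : 2 ≤ m)
    (X : Fin m → Set (EuclideanSpace ℝ (Fin n)))
    (hXne : ∀ i, (X i).Nonempty)
    (hXcpt : ∀ i, IsCompact (X i))
    (hXconv : ∀ i, Convex ℝ (X i))
    (f : Fin m → EuclideanSpace ℝ (Fin n) → ℝ)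
    (hfconv : ∀ i, ConvexOn ℝ Set.univ (f i))
    (xbar : EuclideanSpace ℝ (Fin n)) (ρ : ℝ) (hρ : 0 < ρ)
    (hball : Metric.ball xbar ρ ⊆ ⋂ i, X i)
    (Xstar : Set (EuclideanSpace ℝ (Fin n)))
    (hXstar : Xstar = {p | p ∈ ⋂ i, X i ∧ ∀ y ∈ ⋂ i, X i, ∑ i, f i p ≤ ∑ i, f i y})
    (hXstar_ne : Xstar.Nonempty)
    (a : ℕ → Fin m → Fin m → ℝ)
    (ha_nonneg : ∀ k i j, 0 ≤ a k i j)
    (ha_row : ∀ k i, ∑ j, a k i j = 1)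
    (ha_col : ∀ k j, ∑ i, a k i j = 1)
    (η : ℝ) (hη : η ∈ Set.Ioo (0:ℝ) 1)
    (ha_diag : ∀ k i, η ≤ a k i i)
    (ha_eta : ∀ k i j, 0 < a k i j → η ≤ a k i j)
    (hconn : ∀ u v : Fin m,
      Relation.ReflTransGen (fun p1 p2 => {k : ℕ | 0 < a k p2 p1}.Infinite) u v)
    (T : ℕ) (hT : 1 ≤ T)
    (hTcomm : ∀ j i : Fin m, {k : ℕ | 0 < a k i j}.Infinite →
      ∀ k : ℕ, ∃ l, k ≤ l ∧ l < k + T ∧ 0 < a l i j)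
    (c : ℕ → ℝ) (hc_pos : ∀ k, 0 < c k) (hc_anti : Antitone c)
    (hc_div : Tendsto (fun N => ∑ k ∈ Finset.range N, c k) atTop atTop)
    (hc_sq : Summable (fun k => (c k)^2))
    (x : Fin m → ℕ → EuclideanSpace ℝ (Fin n))
    (hx0 : ∀ i, x i 0 ∈ X i)
    (z : Fin m → ℕ → EuclideanSpace ℝ (Fin n))
    (hz : ∀ i k, z i k = ∑ j, a k i j • x j k)
    (hupd_mem : ∀ i k, x i (k+1) ∈ X i)
    (hupd_min : ∀ i k, ∀ y ∈ X i,
      f i (x i (k+1)) + (1/(2 * c k)) * ‖z i k - x i (k+1)‖^2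
        ≤ f i y + (1/(2 * c k)) * ‖z i k - y‖^2)
    (hupd_uniq : ∀ i k, ∀ y ∈ X i,
      f i y + (1/(2 * c k)) * ‖z i k - y‖^2
        = f i (x i (k+1)) + (1/(2 * c k)) * ‖z i k - x i (k+1)‖^2 → y = x i (k+1))
    :
    ∀ xstar ∈ Xstar, ∀ i, ∃ L : ℝ,
      Tendsto (fun k => ‖x i k - xstar‖) atTop (𝓝 L) := by
  intro p hp i
  rw [hXstar] at hp
  obtain ⟨hpX, hpmin⟩ := hp
  rw [Set.mem_iInter] at hpX
  have : Nonempty (Fin m) := ⟨i⟩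
  have hball' : ∀ i, ball xbar ρ ⊆ X i := Set.subset_iInter_iff.mp hball
  have hx : ∀ i k, x i k ∈ X i := fun i k => by
    cases k with
    | zero => exact hx0 i
    | succ k => exact hupd_mem i k
  obtain ⟨D, hD⟩ : ∃ D, ∀ i k, ‖x i k‖ ≤ D := by
    obtain ⟨D, hD⟩ := (isCompact_iUnion hXcpt).isBounded.exists_norm_le
    exact ⟨D, fun i k => hD _ (Set.mem_iUnion_of_mem i (hx i k))⟩
  obtain ⟨L, hL0, hL⟩ := exists_sum_sub_le_mul_disagreement hXcpt hXconv hfconv hρ hball'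
    (p := p) fun y hy => hpmin y (Set.mem_iInter.mpr hy)
  obtain ⟨C, hC0, hC⟩ := exists_disagreement_sq_le ha_nonneg ha_row hη.1 ha_eta hconn hTcomm x
  obtain ⟨M, hM⟩ := exists_stepResidual_le ha_nonneg ha_row hD
  have hdesc : ∀ k, ∑ i, ‖x i (k + 1) - p‖ ^ 2 + η / 2 * stepResidual a x k
      ≤ ∑ i, ‖x i k - p‖ ^ 2 + 2 * L * (c k * ∑ i, ∑ j, ‖x i (k + 1) - x j (k + 1)‖) := by
    intro k
    have hprox : ∀ i, ‖x i (k + 1) - p‖ ^ 2 + ‖x i (k + 1) - z i k‖ ^ 2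
        + η / 2 * ∑ j, a k i j * ‖x j k - x i k‖ ^ 2
        ≤ ∑ j, a k i j * ‖x j k - p‖ ^ 2 + 2 * c k * (f i p - f i (x i (k + 1))) := by
      intro i
      have h1 := prox_three_point_inequality (hXconv i) (hfconv i) (hc_pos k) (hupd_mem i k)
        (hupd_min i k) (hpX i)
      have h2 := norm_average_sub_sq_add_le (ha_nonneg k i) (ha_row k i) hη.2.le (ha_diag k i)
        (fun j => x j k) p
      rw [← hz] at h2
      linarith
    have hsum := sum_le_sum fun i (_ : i ∈ univ) => hprox i
    simp only [sum_add_distrib, ← mul_sum] at hsum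
    rw [sum_comm (f := fun i j => a k i j * ‖x j k - p‖ ^ 2)] at hsum
    simp only [← sum_mul, ha_col, one_mul] at hsum
    have h3 := mul_le_mul_of_nonneg_left (hL (fun i => x i (k + 1)) fun i => hx i (k + 1))
      (by linarith [hc_pos k] : 0 ≤ 2 * c k)
    have h4 : η / 2 * ∑ i, ‖x i (k + 1) - z i k‖ ^ 2 ≤ ∑ i, ‖x i (k + 1) - z i k‖ ^ 2 :=
      mul_le_of_le_one_left (by positivity) (by linarith [hη.2])
    simp only [stepResidual, ← hz]
    linarith
  obtain ⟨hR, l, hS⟩ := tendsto_of_descent_of_window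
    (S := fun k => ∑ i, ‖x i k - p‖ ^ 2) (R := fun k => ∑ i, ∑ j, ‖x i k - x j k‖)
    (fun k => by positivity) (stepResidual_nonneg ha_nonneg x) hM (fun k => by positivity)
    (fun k => (hc_pos k).le) (half_pos hη.1) (by positivity) hC0 hdesc hC hc_sq
  refine tendsto_of_tendsto_sum_sq (d := fun i k => ‖x i k - p‖) (D := D + ‖p‖)
    (fun i k => norm_nonneg _) (fun i k => (norm_sub_le _ _).trans (by gcongr; exact hD i k))
    (fun i j => squeeze_zero_norm (fun k => ?_) hR) hS i
  calc ‖‖x i k - p‖ - ‖x j k - p‖‖ ≤ ‖x i k - x j k‖ := by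
        simpa using abs_norm_sub_norm_le (x i k - p) (x j k - p)
    _ ≤ ∑ j, ‖x i k - x j k‖ :=
        single_le_sum (f := fun j => ‖x i k - x j k‖) (fun _ _ => norm_nonneg _) (mem_univ j)
    _ ≤ ∑ i, ∑ j, ‖x i k - x j k‖ :=
        single_le_sum (f := fun i => ∑ j, ‖x i k - x j k‖)
          (fun _ _ => sum_nonneg fun _ _ => norm_nonneg _) (mem_univ i)
end

section
/- For every k ≥ 0, ∑_{i=1}^m ‖x_i(k) − v̄(k)‖ ≤ μ ∑_{i=1}^m ‖x_i(k) − v(k)‖, where μ = (2/ρ)mD + 1. -/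
open Filter Finset Metric
open scoped Topology BigOperators

/-- Pulling `v` towards `c` with weight `e / (e + ρ)` moves it by at most `e / ρ * ‖v - c‖`. -/
theorem norm_sub_smul_add_smul_le {E : Type*} [NormedAddCommGroup E] [NormedSpace ℝ E]
    {e ρ : ℝ} (he : 0 ≤ e) (hρ : 0 < ρ) (c v : E) :
    ‖v - ((e / (e + ρ)) • c + (ρ / (e + ρ)) • v)‖ ≤ e / ρ * ‖v - c‖ := by
  have hpos : 0 < e + ρ := by positivity
  have hw : ρ / (e + ρ) = 1 - e / (e + ρ) := by field_simp; ring
  have heq : v - ((e / (e + ρ)) • c + (ρ / (e + ρ)) • v) = (e / (e + ρ)) • (v - c) := by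
    rw [hw]
    module
  rw [heq, norm_smul, Real.norm_of_nonneg (by positivity)]
  gcongr
  linarith

theorem stmt4
    (n m : ℕ) (hm : 1 ≤ m)
    (X : Fin m → Set (EuclideanSpace ℝ (Fin n)))
    (hXne : ∀ i, (X i).Nonempty)
    (hXcpt : ∀ i, IsCompact (X i))
    (hXconv : ∀ i, Convex ℝ (X i))
    (x : Fin m → ℕ → EuclideanSpace ℝ (Fin n))
    (hx : ∀ i k, x i k ∈ X i)
    (D : ℝ) (hD : 0 < D)
    (hDbound : ∀ p ∈ convexHull ℝ (⋃ i, X i), ‖p‖ ≤ D)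
    (xbar : EuclideanSpace ℝ (Fin n)) (ρ : ℝ) (hρ : 0 < ρ)
    (hball : Metric.ball xbar ρ ⊆ ⋂ i, X i)
    (v : ℕ → EuclideanSpace ℝ (Fin n))
    (hv : ∀ k, v k = (m : ℝ)⁻¹ • ∑ i, x i k)
    (eps : ℕ → ℝ)
    (heps : ∀ k, eps k = ∑ i, Metric.infDist (v k) (X i))
    (vbar : ℕ → EuclideanSpace ℝ (Fin n))
    (hvbar : ∀ k, vbar k = (eps k / (eps k + ρ)) • xbar + (ρ / (eps k + ρ)) • v k)
    (μ : ℝ) (hμ : μ = (2 / ρ) * (m : ℝ) * D + 1)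
    :
    ∀ k : ℕ, ∑ i, ‖x i k - vbar k‖ ≤ μ * ∑ i, ‖x i k - v k‖ := by
  intro k
  have hm0 : (0 : ℝ) < m := by exact_mod_cast hm
  have hX : ∀ i, ∀ p ∈ X i, ‖p‖ ≤ D := fun i p hp =>
    hDbound p (subset_convexHull ℝ _ (Set.mem_iUnion_of_mem i hp))
  have hxbar : ‖xbar‖ ≤ D :=
    hX ⟨0, hm⟩ xbar (Set.mem_iInter.1 (hball (mem_ball_self hρ)) _)
  have hvD : ‖v k‖ ≤ D := by
    rw [hv, norm_smul, norm_inv, Real.norm_natCast, inv_mul_le_iff₀ hm0]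
    calc ‖∑ i, x i k‖ ≤ ∑ _i : Fin m, D :=
          norm_sum_le_of_le _ fun i _ => hX i _ (hx i k)
      _ = m * D := by simp
  have hdist : ‖v k - xbar‖ ≤ 2 * D := (norm_sub_le _ _).trans (by linarith)
  have heps0 : 0 ≤ eps k := by
    rw [heps]
    exact sum_nonneg fun i _ => infDist_nonneg
  have hepsS : eps k ≤ ∑ i, ‖x i k - v k‖ := by
    rw [heps]
    refine sum_le_sum fun i _ => ?_
    rw [← dist_eq_norm, dist_comm]
    exact infDist_le_dist_of_mem (hx i k)
  set S := ∑ i, ‖x i k - v k‖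
  have hmove : ‖v k - vbar k‖ ≤ S / ρ * (2 * D) := by
    rw [hvbar]
    refine (norm_sub_smul_add_smul_le heps0 hρ xbar (v k)).trans ?_
    gcongr
  calc ∑ i, ‖x i k - vbar k‖ ≤ ∑ i, (‖x i k - v k‖ + S / ρ * (2 * D)) :=
        sum_le_sum fun i _ => (norm_sub_le_norm_sub_add_norm_sub _ _ _).trans (by gcongr)
    _ = S + m * (S / ρ * (2 * D)) := by simp [sum_add_distrib, S]
    _ = μ * S := by rw [hμ]; ring
end

section
/- For all integers k > s ≥ 0 and all i = 1,…,m, ‖x_i(k+1) − v(k+1)‖ ≤ λ q^{k−s} ∑_{j=1}^m ‖x_j(s)‖ + ∑_{r=s}^{k−1} λ q^{k−r−1} ∑_{j=1}^m ‖e_j(r+1)‖ + ‖e_i(k+1)‖ + (1/m)∑_{j=1}^m ‖e_j(k+1)‖, where λ = 2(1 + η^{−(m−1)T})/(1 − η^{(m−1)T}) and q = (1 − η^{(m−1)T})^{1/((m−1)T)} ∈ (0,1). -/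
open Filter Finset Metric
open scoped Topology BigOperators

/-- The transition matrix `a (s + t - 1) * ⋯ * a s` of a time-varying linear system. -/
def transitionMatrix {ι : Type*} [Fintype ι] [DecidableEq ι] (a : ℕ → Matrix ι ι ℝ) :
    ℕ → ℕ → Matrix ι ι ℝ
  | _, 0 => 1
  | s, t + 1 => transitionMatrix a (s + 1) t * a s

section TransitionMatrix

variable {ι : Type*} [Fintype ι] [DecidableEq ι] {a : ℕ → Matrix ι ι ℝ}

lemma transitionMatrix_add (s t u : ℕ) :
    transitionMatrix a s (t + u) = transitionMatrix a (s + t) u * transitionMatrix a s t := by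
  induction t generalizing s with
  | zero => simp [transitionMatrix]
  | succ t ih =>
    rw [Nat.add_right_comm, transitionMatrix, ih, transitionMatrix, mul_assoc,
      Nat.add_right_comm s 1 t, add_assoc s t 1]

lemma transitionMatrix_succ (s t : ℕ) :
    transitionMatrix a s (t + 1) = a (s + t) * transitionMatrix a s t := by
  rw [transitionMatrix_add]
  simp [transitionMatrix]

lemma transitionMatrix_mem_doublyStochastic (ha : ∀ k, a k ∈ doublyStochastic ℝ ι) (s t : ℕ) :
    transitionMatrix a s t ∈ doublyStochastic ℝ ι := by
  induction t generalizing s with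
  | zero => exact one_mem _
  | succ t ih => exact mul_mem (ih _) (ha s)

lemma transitionMatrix_succ_pos (ha : ∀ k, a k ∈ doublyStochastic ℝ ι) {s t : ℕ} {i u j : ι}
    (hiu : 0 < a (s + t) i u) (huj : 0 < transitionMatrix a s t u j) :
    0 < transitionMatrix a s (t + 1) i j := by
  rw [transitionMatrix_succ, Matrix.mul_apply]
  exact Finset.sum_pos' (fun l _ => mul_nonneg (nonneg_of_mem_doublyStochastic (ha _))
    (nonneg_of_mem_doublyStochastic (transitionMatrix_mem_doublyStochastic ha s t)))
    ⟨u, Finset.mem_univ u, mul_pos hiu huj⟩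

lemma transitionMatrix_add_pos (ha : ∀ k, a k ∈ doublyStochastic ℝ ι)
    (hdiag : ∀ k i, 0 < a k i i) {s t : ℕ} (u : ℕ) {i j : ι}
    (h : 0 < transitionMatrix a s t i j) : 0 < transitionMatrix a s (t + u) i j := by
  induction u with
  | zero => exact h
  | succ u ih => exact transitionMatrix_succ_pos ha (hdiag _ i) ih

lemma pow_le_transitionMatrix_of_pos (ha : ∀ k, a k ∈ doublyStochastic ℝ ι) {η : ℝ} (hη : 0 ≤ η)
    (haη : ∀ k i j, 0 < a k i j → η ≤ a k i j) {s t : ℕ} {i j : ι}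
    (h : 0 < transitionMatrix a s t i j) : η ^ t ≤ transitionMatrix a s t i j := by
  induction t generalizing i with
  | zero =>
    obtain rfl | hij := eq_or_ne i j
    · simp [transitionMatrix]
    · simp [transitionMatrix, hij] at h
  | succ t ih =>
    have hP : ∀ l, 0 ≤ transitionMatrix a s t l j := fun l =>
      nonneg_of_mem_doublyStochastic (transitionMatrix_mem_doublyStochastic ha s t)
    have hA : ∀ l, 0 ≤ a (s + t) i l := fun l => nonneg_of_mem_doublyStochastic (ha _)
    rw [transitionMatrix_succ, Matrix.mul_apply] at h ⊢
    obtain ⟨l, -, hl⟩ := Finset.exists_lt_of_sum_lt (by simpa using h :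
      ∑ _l : ι, (0 : ℝ) < ∑ l, a (s + t) i l * transitionMatrix a s t l j)
    have hl1 : 0 < a (s + t) i l := pos_of_mul_pos_left hl (hP l)
    have hl2 : 0 < transitionMatrix a s t l j := pos_of_mul_pos_right hl (hA l)
    calc η ^ (t + 1) = η * η ^ t := pow_succ' η t
      _ ≤ a (s + t) i l * transitionMatrix a s t l j :=
        mul_le_mul (haη _ _ _ hl1) (ih hl2) (pow_nonneg hη t) (hA l)
      _ ≤ _ := Finset.single_le_sum
        (f := fun l => a (s + t) i l * transitionMatrix a s t l j)
        (fun l _ => mul_nonneg (hA l) (hP l)) (Finset.mem_univ l)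

omit [Fintype ι] [DecidableEq ι] in
lemma exists_rel_leaving_of_reflTransGen {r : ι → ι → Prop} {u w : ι}
    (h : Relation.ReflTransGen r u w) {S : Set ι} (hu : u ∈ S) (hw : w ∉ S) :
    ∃ p ∈ S, ∃ p' ∉ S, r p p' := by
  induction h with
  | refl => exact absurd hu hw
  | @tail b c _ hbc ih =>
    by_cases hb : b ∈ S
    · exact ⟨b, hb, c, hw, hbc⟩
    · exact ih hb

lemma lt_card_support_transitionMatrix (ha : ∀ k, a k ∈ doublyStochastic ℝ ι)
    (hdiag : ∀ k i, 0 < a k i i) {r : ι → ι → Prop} (hr : ∀ u w, Relation.ReflTransGen r u w)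
    {T : ℕ} (hT : ∀ j i, r j i → ∀ k, ∃ l, k ≤ l ∧ l < k + T ∧ 0 < a l i j)
    (s : ℕ) (j : ι) {c : ℕ} (hc : c < Fintype.card ι) :
    c < #{i | 0 < transitionMatrix a s (c * T) i j} := by
  induction c with
  | zero =>
    exact Finset.card_pos.2 ⟨j, by simp [transitionMatrix]⟩
  | succ c ih =>
    refine (Nat.succ_le_of_lt (ih (by omega))).lt_or_eq.elim (fun h => ?_) fun h => ?_
    · refine h.trans_le (Finset.card_le_card fun i hi => ?_)
      rw [Finset.mem_filter] at hi ⊢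
      exact ⟨hi.1, by rw [Nat.succ_mul]; exact transitionMatrix_add_pos ha hdiag T hi.2⟩
    · obtain ⟨w, hw⟩ : ∃ w, ¬ 0 < transitionMatrix a s (c * T) w j := by
        by_contra! hall
        rw [Finset.filter_true_of_mem fun i _ => hall i, Finset.card_univ] at h
        omega
      have hj : 0 < transitionMatrix a s (c * T) j j := by
        have := transitionMatrix_add_pos ha hdiag (s := s) (t := 0) (c * T) (i := j) (j := j)
          (by simp [transitionMatrix])
        rwa [zero_add] at this
      obtain ⟨p, hp, p', hp', hpp⟩ := exists_rel_leaving_of_reflTransGen (hr j w)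
        (S := {i | 0 < transitionMatrix a s (c * T) i j}) hj hw
      obtain ⟨l, hl, hlT, hal⟩ := hT _ _ hpp (s + c * T)
      obtain ⟨d, rfl⟩ := Nat.exists_eq_add_of_le hl
      obtain ⟨f, rfl⟩ : ∃ f, T = d + 1 + f := Nat.exists_eq_add_of_le (by omega)
      refine h.le.trans_lt (Finset.card_lt_card ((Finset.ssubset_iff_of_subset fun i hi => ?_).2
        ⟨p', ?_, fun h => hp' (Finset.mem_filter.1 h).2⟩))
      · rw [Finset.mem_filter] at hi ⊢
        exact ⟨hi.1, by rw [Nat.succ_mul]; exact transitionMatrix_add_pos ha hdiag _ hi.2⟩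
      · rw [Finset.mem_filter, Nat.succ_mul, ← add_assoc, ← add_assoc]
        refine ⟨Finset.mem_univ _, transitionMatrix_add_pos ha hdiag f ?_⟩
        refine transitionMatrix_succ_pos ha (by rwa [← add_assoc]) ?_
        exact transitionMatrix_add_pos ha hdiag d hp

lemma pow_le_transitionMatrix (ha : ∀ k, a k ∈ doublyStochastic ℝ ι)
    {η : ℝ} (hη : 0 < η) (hdiag : ∀ k i, η ≤ a k i i)
    (haη : ∀ k i j, 0 < a k i j → η ≤ a k i j)
    {r : ι → ι → Prop} (hr : ∀ u w, Relation.ReflTransGen r u w)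
    {T : ℕ} (hT : ∀ j i, r j i → ∀ k, ∃ l, k ≤ l ∧ l < k + T ∧ 0 < a l i j)
    (s : ℕ) (i j : ι) :
    η ^ ((Fintype.card ι - 1) * T) ≤
      transitionMatrix a s ((Fintype.card ι - 1) * T) i j := by
  have hcard : 0 < Fintype.card ι := Fintype.card_pos_iff.2 ⟨i⟩
  have h := lt_card_support_transitionMatrix ha (fun k i => hη.trans_le (hdiag k i)) hr hT s j
    (Nat.sub_lt hcard one_pos)
  have huniv := (Finset.card_eq_iff_eq_univ _).1
    ((Finset.card_le_univ _).antisymm (Nat.le_of_pred_lt h))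
  exact pow_le_transitionMatrix_of_pos ha hη.le haη
    (Finset.filter_eq_self.1 huniv i (Finset.mem_univ i))

omit [DecidableEq ι] in
lemma sum_mul_sub_sum_mul_le {b c y : ι → ℝ} {β d : ℝ} (hβ : 0 ≤ β) (hβ1 : β ≤ 1)
    (hb : ∀ l, β ≤ b l) (hc : ∀ l, 0 ≤ c l) (hb1 : ∑ l, b l = 1) (hc1 : ∑ l, c l = 1)
    (hy : ∀ l l', y l - y l' ≤ d) :
    ∑ l, b l * y l - ∑ l, c l * y l ≤ (1 - β) * d := by
  have : Nonempty ι := by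
    by_contra h
    rw [not_nonempty_iff] at h
    simp at hb1
  obtain ⟨p, hp⟩ := Finite.exists_max y
  obtain ⟨p', hp'⟩ := Finite.exists_min y
  have h1 : β * (y p - y p') ≤ ∑ l, b l * (y p - y l) :=
    (mul_le_mul_of_nonneg_right (hb p') (sub_nonneg.2 (hp p'))).trans
      (Finset.single_le_sum (f := fun l => b l * (y p - y l))
        (fun l _ => mul_nonneg (hβ.trans (hb l)) (sub_nonneg.2 (hp l))) (Finset.mem_univ p'))
  have h2 : 0 ≤ ∑ l, c l * (y l - y p') :=
    Finset.sum_nonneg fun l _ => mul_nonneg (hc l) (sub_nonneg.2 (hp' l))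
  simp only [mul_sub, Finset.sum_sub_distrib, ← Finset.sum_mul, hb1, hc1, one_mul] at h1 h2
  nlinarith [mul_le_mul_of_nonneg_left (hy p p') (sub_nonneg.2 hβ1)]

lemma transitionMatrix_sub_le_pow (ha : ∀ k, a k ∈ doublyStochastic ℝ ι) {β : ℝ} (hβ : 0 ≤ β)
    (hβ1 : β ≤ 1) {N : ℕ} (hN : ∀ s i j, β ≤ transitionMatrix a s N i j) (s r c : ℕ) (i i' j : ι) :
    transitionMatrix a s (r + c * N) i j - transitionMatrix a s (r + c * N) i' j
      ≤ (1 - β) ^ c := by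
  have hP := transitionMatrix_mem_doublyStochastic ha
  induction c generalizing i i' with
  | zero =>
    have h1 : transitionMatrix a s (r + 0 * N) i j ≤ 1 := le_one_of_mem_doublyStochastic (hP _ _)
    have h0 : 0 ≤ transitionMatrix a s (r + 0 * N) i' j := nonneg_of_mem_doublyStochastic (hP _ _)
    rw [pow_zero]
    linarith
  | succ c ih =>
    rw [Nat.succ_mul, ← add_assoc, transitionMatrix_add, Matrix.mul_apply, Matrix.mul_apply,
      pow_succ']
    exact sum_mul_sub_sum_mul_le hβ hβ1 (hN _ i) (fun l => hβ.trans (hN _ i' l))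
      (sum_row_of_mem_doublyStochastic (hP _ _) i) (sum_row_of_mem_doublyStochastic (hP _ _) i') ih

lemma abs_transitionMatrix_sub_inv_card_le (ha : ∀ k, a k ∈ doublyStochastic ℝ ι) {β q : ℝ}
    (hβ : 0 ≤ β) (hβ1 : β < 1) {N : ℕ} (hN : ∀ s i j, β ≤ transitionMatrix a s N i j)
    (hq : 0 ≤ q) (hq1 : q ≤ 1) (hqN : q ^ N = 1 - β) (hN0 : 0 < N) (s t : ℕ) (i j : ι) :
    |transitionMatrix a s t i j - (Fintype.card ι : ℝ)⁻¹| ≤ q ^ t / (1 - β) := by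
  have hcard : 0 < (Fintype.card ι : ℝ) := Nat.cast_pos.2 (Fintype.card_pos_iff.2 ⟨i⟩)
  have hspread : ∀ i i', transitionMatrix a s t i j - transitionMatrix a s t i' j
      ≤ q ^ t / (1 - β) := fun i i' => by
    have h := transitionMatrix_sub_le_pow ha hβ hβ1.le hN s (t % N) (t / N) i i' j
    rw [Nat.mod_add_div' t N] at h
    refine h.trans ((le_div_iff₀ (sub_pos.2 hβ1)).2 ?_)
    rw [← pow_succ, ← hqN, ← pow_mul]
    exact pow_le_pow_of_le_one hq hq1 (Nat.lt_mul_div_succ t hN0).le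
  have hsum := sum_col_of_mem_doublyStochastic (transitionMatrix_mem_doublyStochastic ha s t) j
  have hupper := Finset.sum_le_sum fun i' (_ : i' ∈ Finset.univ) => hspread i i'
  have hlower := Finset.sum_le_sum fun i' (_ : i' ∈ Finset.univ) => hspread i' i
  simp only [Finset.sum_sub_distrib, hsum, Finset.sum_const, Finset.card_univ, nsmul_eq_mul]
    at hupper hlower
  rw [abs_sub_le_iff]
  constructor
  · refine le_of_mul_le_mul_left ?_ hcard
    rwa [mul_sub, mul_inv_cancel₀ hcard.ne']
  · refine le_of_mul_le_mul_left ?_ hcard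
    rwa [mul_sub, mul_inv_cancel₀ hcard.ne']

end TransitionMatrix

section PerturbedConsensus

variable {ι E : Type*} [Fintype ι] [NormedAddCommGroup E] [NormedSpace ℝ E]

lemma norm_sum_smul_le_mul_sum_norm {w : ι → ℝ} {C : ℝ} (hw : ∀ j, |w j| ≤ C) (y : ι → E) :
    ‖∑ j, w j • y j‖ ≤ C * ∑ j, ‖y j‖ := by
  rw [Finset.mul_sum]
  refine norm_sum_le_of_le _ fun j _ => ?_
  rw [norm_smul, Real.norm_eq_abs]
  exact mul_le_mul_of_nonneg_right (hw j) (norm_nonneg _)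

variable [DecidableEq ι] {a : ℕ → Matrix ι ι ℝ}

lemma sum_transitionMatrix_sub_smul_succ (ha : ∀ k, a k ∈ doublyStochastic ℝ ι) {x e : ι → ℕ → E}
    (hrec : ∀ i k, x i (k + 1) = (∑ j, a k i j • x j k) + e i (k + 1)) (s t : ℕ) (c : ℝ) (i : ι) :
    ∑ j, (transitionMatrix a (s + 1) t i j - c) • x j (s + 1) =
      ∑ j, (transitionMatrix a s (t + 1) i j - c) • x j s +
        ∑ j, (transitionMatrix a (s + 1) t i j - c) • e j (s + 1) := by
  simp only [hrec, smul_add, Finset.sum_add_distrib, Finset.smul_sum, smul_smul]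
  rw [Finset.sum_comm]
  congr 1
  refine Finset.sum_congr rfl fun l _ => ?_
  rw [← Finset.sum_smul]
  congr 1
  simp only [sub_mul, Finset.sum_sub_distrib, ← Finset.mul_sum,
    sum_col_of_mem_doublyStochastic (ha s) l, mul_one, transitionMatrix, Matrix.mul_apply]

lemma norm_sub_average_le (ha : ∀ k, a k ∈ doublyStochastic ℝ ι) {x e : ι → ℕ → E}
    (hrec : ∀ i k, x i (k + 1) = (∑ j, a k i j • x j k) + e i (k + 1)) {c : ℝ} (hc : 0 ≤ c)
    {g : ℕ → ℝ} (hg : ∀ s t i j, |transitionMatrix a s (t + 1) i j - c| ≤ g t)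
    {s k : ℕ} (hsk : s ≤ k) (i : ι) :
    ‖x i (k + 1) - c • ∑ j, x j (k + 1)‖ ≤ g (k - s) * ∑ j, ‖x j s‖
      + (∑ r ∈ Finset.Ico s k, g (k - r - 1) * ∑ j, ‖e j (r + 1)‖)
      + ‖e i (k + 1)‖ + c * ∑ j, ‖e j (k + 1)‖ := by
  have key : ∀ t s, s + t = k → ‖x i (k + 1) - c • ∑ j, x j (k + 1)‖ ≤
      ‖∑ j, (transitionMatrix a s (t + 1) i j - c) • x j s‖
      + (∑ r ∈ Finset.Ico s k, g (k - r - 1) * ∑ j, ‖e j (r + 1)‖)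
      + ‖e i (k + 1)‖ + c * ∑ j, ‖e j (k + 1)‖ := by
    have hone : ∀ y : ι → E, ∀ s, ∑ j, (transitionMatrix a s 0 i j - c) • y j =
        y i - c • ∑ j, y j := fun y s => by
      simp [transitionMatrix, sub_smul, Finset.smul_sum, Matrix.one_apply]
    intro t
    induction t with
    | zero =>
      rintro s rfl
      have h := sum_transitionMatrix_sub_smul_succ ha hrec s 0 c i
      rw [hone, hone] at h
      rw [add_zero, h, Finset.Ico_self, Finset.sum_empty, add_zero, add_assoc]
      refine (norm_add_le _ _).trans (add_le_add_right ((norm_sub_le _ _).trans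
        (add_le_add_right ?_ _)) _)
      rw [norm_smul, Real.norm_of_nonneg hc]
      exact mul_le_mul_of_nonneg_left (norm_sum_le _ _) hc
    | succ t ih =>
      intro s hs
      have h := ih (s + 1) (by omega)
      rw [sum_transitionMatrix_sub_smul_succ ha hrec] at h
      have he := norm_sum_smul_le_mul_sum_norm (hg (s + 1) t i) fun j => e j (s + 1)
      have htri := norm_add_le (∑ j, (transitionMatrix a s (t + 1 + 1) i j - c) • x j s)
        (∑ j, (transitionMatrix a (s + 1) (t + 1) i j - c) • e j (s + 1))
      rw [Finset.sum_eq_sum_Ico_succ_bot (by omega), show k - s - 1 = t by omega]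
      linarith
  refine (key (k - s) s (by omega)).trans ?_
  gcongr
  exact norm_sum_smul_le_mul_sum_norm (hg s (k - s) i) _

end PerturbedConsensus

theorem stmt5
    (n m : ℕ) (hm : 2 ≤ m)
    (x e : Fin m → ℕ → EuclideanSpace ℝ (Fin n))
    (a : ℕ → Fin m → Fin m → ℝ)
    (ha_nonneg : ∀ k i j, 0 ≤ a k i j)
    (ha_row : ∀ k i, ∑ j, a k i j = 1)
    (ha_col : ∀ k j, ∑ i, a k i j = 1)
    (η : ℝ) (hη : η ∈ Set.Ioo (0:ℝ) 1)
    (ha_diag : ∀ k i, η ≤ a k i i)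
    (ha_eta : ∀ k i j, 0 < a k i j → η ≤ a k i j)
    (hconn : ∀ u v : Fin m,
      Relation.ReflTransGen (fun p1 p2 => {k : ℕ | 0 < a k p2 p1}.Infinite) u v)
    (T : ℕ) (hT : 1 ≤ T)
    (hTcomm : ∀ j i : Fin m, {k : ℕ | 0 < a k i j}.Infinite →
      ∀ k : ℕ, ∃ l, k ≤ l ∧ l < k + T ∧ 0 < a l i j)
    (hrec : ∀ i k, x i (k + 1) = (∑ j, a k i j • x j k) + e i (k + 1))
    (v : ℕ → EuclideanSpace ℝ (Fin n))
    (hv : ∀ k, v k = (m : ℝ)⁻¹ • ∑ i, x i k)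
    (lam q : ℝ)
    (hlam : lam = 2 * (1 + (η ^ ((m - 1) * T))⁻¹) / (1 - η ^ ((m - 1) * T)))
    (hq : q = Real.rpow (1 - η ^ ((m - 1) * T)) ((((m - 1) * T : ℕ) : ℝ))⁻¹)
    :
    ∀ s k : ℕ, s < k → ∀ i,
      ‖x i (k + 1) - v (k + 1)‖
        ≤ lam * q ^ (k - s) * ∑ j, ‖x j s‖
          + (∑ r ∈ Finset.Ico s k, lam * q ^ (k - r - 1) * ∑ j, ‖e j (r + 1)‖)
          + ‖e i (k + 1)‖ + (m : ℝ)⁻¹ * ∑ j, ‖e j (k + 1)‖ := by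
  have hm1 : 0 < (m - 1) * T := Nat.mul_pos (by omega) hT
  set N := (m - 1) * T with hN
  have hβ : 0 < η ^ N := pow_pos hη.1 N
  have hβ1 : η ^ N < 1 := pow_lt_one₀ hη.1.le hη.2 hm1.ne'
  have hβ' : 0 < 1 - η ^ N := sub_pos.2 hβ1
  have hq0 : 0 ≤ q := hq ▸ Real.rpow_nonneg hβ'.le _
  have hqN : q ^ N = 1 - η ^ N := hq ▸ Real.rpow_inv_natCast_pow hβ'.le hm1.ne'
  have hq1 : q ≤ 1 := hq ▸ Real.rpow_le_one hβ'.le (by linarith) (by positivity)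
  have ha : ∀ k, (a k : Matrix (Fin m) (Fin m) ℝ) ∈ doublyStochastic ℝ (Fin m) := fun k =>
    mem_doublyStochastic_iff_sum.2 ⟨ha_nonneg k, ha_row k, ha_col k⟩
  have hlow := pow_le_transitionMatrix ha hη.1 ha_diag ha_eta hconn hTcomm
  rw [Fintype.card_fin, ← hN] at hlow
  intro s k hsk i
  rw [hv]
  refine norm_sub_average_le ha hrec (by positivity) (g := fun t => lam * q ^ t) ?_ hsk.le i
  intro s t i j
  have h := abs_transitionMatrix_sub_inv_card_le ha hβ.le hβ1 hlow hq0 hq1 hqN hm1 s (t + 1) i j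
  rw [Fintype.card_fin] at h
  refine h.trans ?_
  rw [hlam, div_mul_eq_mul_div]
  have hinv : 0 < (η ^ N)⁻¹ := inv_pos.2 hβ
  gcongr
  calc q ^ (t + 1) ≤ q ^ t := pow_le_pow_of_le_one hq0 hq1 t.le_succ
    _ ≤ 2 * (1 + (η ^ N)⁻¹) * q ^ t := le_mul_of_one_le_left (pow_nonneg hq0 t) (by linarith)
end
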